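/- arXiv:2506.16704 — 8 statements merged into one kernel-verified Lean document; each statement's English description precedes it below -/
import Mathlib

section
/- There exists an absolute constant C > 0 with the following property. Let X be a set, let H be a countable class of hypotheses h : X → {0,1}, let G be a family of domains (probability distributions on X × {0,1}), let τ, α ∈ [0,1], and let d := Gdim(H, G, τ, α) be finite. For every ε, δ ∈ (0,1/2), every n ≥ 2, and every probability distribution P over G such that there exists h* ∈ H with err_D(h*) ≤ τ − α − 2ε for P-almost every D, the following holds with probability at least 1 − δ over an i.i.d. sample D_1, …, D_n drawn from P: for every collection of real numbers ê_i(h) (i ∈ [n], h ∈ H) satisfying |ê_i(h) − err_{D_i}(h)| < ε for all i and h, every ĥ ∈ H attaining the minimum over h ∈ H of max_{i ∈ [n]} ê_i(h) satisfies Pr_{D ∼ P}[err_D(ĥ) > τ] ≤ C·(d·(log n)² + log(1/δ))/n. -/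
open MeasureTheory
open scoped ENNReal

/-- The error of hypothesis `h` on domain `D`: `err_D(h) = Pr_{(x,y)~D}[y ≠ h(x)]`. -/
noncomputable def errD {X : Type*} [MeasurableSpace (X × Bool)]
    (D : Measure (X × Bool)) (h : X → Bool) : ℝ :=
  (D {p : X × Bool | p.2 ≠ h p.1}).toReal

/-- `S` is `α`-shattered by `H` at threshold `τ`. -/
def AlphaShattered {X : Type*} [MeasurableSpace (X × Bool)]
    (H : Set (X → Bool)) (S : Set (Measure (X × Bool))) (τ α : ℝ) : Prop :=
  ∀ E ⊆ S, ∃ h ∈ H, (∀ D ∈ E, errD D h < τ - α) ∧ ∀ D ∈ S \ E, τ < errD D h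

/-- The domain shattering dimension `Gdim(H, G, τ, α)`. -/
noncomputable def Gdim {X : Type*} [MeasurableSpace (X × Bool)]
    (H : Set (X → Bool)) (G : Set (Measure (X × Bool))) (τ α : ℝ) : ℕ∞ :=
  ⨆ (S : Finset (Measure (X × Bool)))
    (_ : (S : Set (Measure (X × Bool))) ⊆ G ∧
      AlphaShattered H (S : Set (Measure (X × Bool))) τ α),
    (S.card : ℕ∞)

/-- The restriction of the partial concepts `c h`, `h ∈ F`, shatters the finite set `S`. -/
def PartialShatters {K V : Type*} (c : K → V → Option Bool) (F : Set K) (S : Finset V) : Prop :=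
  ∀ g : V → Bool, ∃ h ∈ F, ∀ v ∈ S, c h v = some (g v)

open Classical in
/-- The finite sets shattered by a partial concept class. -/
noncomputable def partialShatterer {K V : Type*} [Fintype V] (c : K → V → Option Bool)
    (F : Set K) : Finset (Finset V) :=
  Finset.univ.filter (PartialShatters c F)

theorem mem_partialShatterer {K V : Type*} [Fintype V] {c : K → V → Option Bool}
    {F : Set K} {S : Finset V} : S ∈ partialShatterer c F ↔ PartialShatters c F S := by
  simp [partialShatterer]

theorem PartialShatters.mono {K V : Type*} {c : K → V → Option Bool} {F F' : Set K}
    {S : Finset V} (h : PartialShatters c F S) (hF : F ⊆ F') : PartialShatters c F' S := fun g =>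
  let ⟨k, hk, hg⟩ := h g
  ⟨k, hF hk, hg⟩

theorem PartialShatters.notMem_of_restrict {K V : Type*} {c : K → V → Option Bool} {F : Set K}
    {S : Finset V} {x : V} {b : Bool} (h : PartialShatters c {k ∈ F | c k x = some b} S) :
    x ∉ S := by
  intro hx
  obtain ⟨k, hk, hg⟩ := h fun _ => !b
  have h1 := hg x hx
  rw [hk.2] at h1
  simp at h1

/-- Splitting a class according to the value at a point splits the family of shattered sets. -/
theorem card_partialShatterer_add_le {K V : Type*} [Fintype V] (c : K → V → Option Bool)
    (F : Set K) (x : V) :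
    (partialShatterer c {k ∈ F | c k x = some false}).card +
      (partialShatterer c {k ∈ F | c k x = some true}).card ≤ (partialShatterer c F).card := by
  classical
  set A := partialShatterer c {k ∈ F | c k x = some false}
  set B := partialShatterer c {k ∈ F | c k x = some true}
  have hA : ∀ S ∈ A, x ∉ S := fun S hS => (mem_partialShatterer.1 hS).notMem_of_restrict
  have hB : ∀ S ∈ B, x ∉ S := fun S hS => (mem_partialShatterer.1 hS).notMem_of_restrict
  rw [← Finset.card_union_add_card_inter]
  have hinj : ((A ∩ B).image (insert x)).card = (A ∩ B).card := by
    refine Finset.card_image_of_injOn fun S hS T hT hST => ?_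
    have h1 : x ∉ S := hA S (Finset.mem_inter.1 hS).1
    have h2 : x ∉ T := hA T (Finset.mem_inter.1 hT).1
    rw [← Finset.erase_insert h1, ← Finset.erase_insert h2]
    exact congrArg (fun U => Finset.erase U x) hST
  rw [← hinj, ← Finset.card_union_of_disjoint]
  · refine Finset.card_le_card (Finset.union_subset (Finset.union_subset ?_ ?_) ?_)
    · exact fun S hS => mem_partialShatterer.2
        ((mem_partialShatterer.1 hS).mono (Set.sep_subset _ _))
    · exact fun S hS => mem_partialShatterer.2
        ((mem_partialShatterer.1 hS).mono (Set.sep_subset _ _))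
    · intro S hS
      obtain ⟨T, hT, rfl⟩ := Finset.mem_image.1 hS
      obtain ⟨hTA, hTB⟩ := Finset.mem_inter.1 hT
      refine mem_partialShatterer.2 fun g => ?_
      have : ∃ k ∈ {k ∈ F | c k x = some (g x)}, ∀ v ∈ T, c k v = some (g v) := by
        cases hg : g x
        · exact mem_partialShatterer.1 hTA g
        · exact mem_partialShatterer.1 hTB g
      obtain ⟨k, hk, hkT⟩ := this
      refine ⟨k, hk.1, fun v hv => ?_⟩
      rcases Finset.mem_insert.1 hv with rfl | hv
      · exact hk.2
      · exact hkT v hv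
  · refine Finset.disjoint_left.2 fun S hS hS' => ?_
    obtain ⟨T, -, rfl⟩ := Finset.mem_image.1 hS'
    rcases Finset.mem_union.1 hS with h | h
    · exact hA _ h (Finset.mem_insert_self _ _)
    · exact hB _ h (Finset.mem_insert_self _ _)

/-- The total concepts in `T` disambiguate the partial concepts `c h`, `h ∈ F`. -/
def Disambiguates {K V : Type*} (c : K → V → Option Bool) (F : Set K)
    (T : Finset (V → Bool)) : Prop :=
  ∀ h ∈ F, ∃ f ∈ T, ∀ v b, c h v = some b → f v = b

theorem eq_empty_of_card_partialShatterer_eq_zero {K V : Type*} [Fintype V]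
    {c : K → V → Option Bool} {F : Set K} (h : (partialShatterer c F).card = 0) : F = ∅ := by
  by_contra hne
  obtain ⟨k, hk⟩ := Set.nonempty_iff_ne_empty.2 hne
  have : ∅ ∈ partialShatterer c F :=
    mem_partialShatterer.2 fun _ => ⟨k, hk, by simp⟩
  rw [Finset.card_eq_zero.1 h] at this
  simp at this

/-- Disambiguation by the halving algorithm, with majorities taken over shattered sets. -/
theorem exists_disambiguates {K V : Type*} [Fintype V] (c : K → V → Option Bool) (L : ℕ) :
    ∀ F : Set K, (partialShatterer c F).card < 2 ^ (L + 1) →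
      ∃ T : Finset (V → Bool), T.card ≤ (Fintype.card V + 1) ^ L ∧ Disambiguates c F T := by
  classical
  have majority : ∀ (F : Set K) (m : ℕ), (partialShatterer c F).card < 2 * m →
      ∃ f : V → Bool, ∀ x, (partialShatterer c {k ∈ F | c k x = some (!f x)}).card < m := by
    intro F m hF
    have : ∀ x, ∃ b : Bool, (partialShatterer c {k ∈ F | c k x = some (!b)}).card < m := by
      intro x
      have := card_partialShatterer_add_le c F x
      by_cases h : (partialShatterer c {k ∈ F | c k x = some false}).card < m
      · exact ⟨true, h⟩
      · exact ⟨false, by simp only [Bool.not_false]; omega⟩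
    choose f hf using this
    exact ⟨f, hf⟩
  have agree_or : ∀ (f : V → Bool) (h : K), (∀ v b, c h v = some b → f v = b) ∨
      ∃ x, c h x = some (!f x) := by
    intro f h
    by_contra! hcon
    obtain ⟨⟨v, b, hv, hb⟩, h2⟩ := hcon
    apply h2 v
    rw [hv]
    congr 1
    revert hb
    cases f v <;> cases b <;> simp
  induction L with
  | zero =>
    intro F hF
    obtain ⟨f, hf⟩ := majority F 1 (by simpa using hF)
    refine ⟨{f}, by simp, fun h hh => ⟨f, by simp, ?_⟩⟩
    rcases agree_or f h with h1 | ⟨x, hx⟩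
    · exact h1
    · have := eq_empty_of_card_partialShatterer_eq_zero (Nat.lt_one_iff.1 (hf x))
      exact absurd (show h ∈ {k ∈ F | c k x = some (!f x)} from ⟨hh, hx⟩) (by simp [this])
  | succ L ih =>
    intro F hF
    obtain ⟨f, hf⟩ := majority F (2 ^ (L + 1)) (by rw [pow_succ] at hF; omega)
    choose T hTc hT using fun x => ih _ (hf x)
    refine ⟨insert f (Finset.univ.biUnion T), ?_, fun h hh => ?_⟩
    · calc (insert f (Finset.univ.biUnion T)).card
          ≤ (Finset.univ.biUnion T).card + 1 := Finset.card_insert_le _ _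
        _ ≤ Fintype.card V * (Fintype.card V + 1) ^ L + 1 := by
          gcongr
          exact Finset.card_biUnion_le_card_mul _ _ _ fun x _ => hTc x
        _ ≤ Fintype.card V * (Fintype.card V + 1) ^ L + (Fintype.card V + 1) ^ L := by
          gcongr
          exact Nat.one_le_pow _ _ (Nat.succ_pos _)
        _ = (Fintype.card V + 1) ^ (L + 1) := by ring
    · rcases agree_or f h with h1 | ⟨x, hx⟩
      · exact ⟨f, by simp, h1⟩
      · obtain ⟨t, ht, hag⟩ := hT x h ⟨hh, hx⟩
        exact ⟨t, Finset.mem_insert_of_mem (Finset.mem_biUnion.2 ⟨x, Finset.mem_univ _, ht⟩), hag⟩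

theorem card_filter_card_le_le_pow (V : Type*) [Fintype V] (d : ℕ) :
    (Finset.univ.filter fun S : Finset V => S.card ≤ d).card ≤ (Fintype.card V + 1) ^ d := by
  classical
  induction d with
  | zero => simp [Finset.filter_eq']
  | succ d ih =>
    have hsub : (Finset.univ.filter fun S : Finset V => S.card ≤ d + 1) ⊆
        ((Finset.univ : Finset (Option V)) ×ˢ
          Finset.univ.filter fun S : Finset V => S.card ≤ d).image
            fun p => p.1.elim p.2 fun x => insert x p.2 := by
      intro S hS
      simp only [Finset.mem_filter, Finset.mem_univ, true_and] at hS
      simp only [Finset.mem_image, Finset.mem_product, Finset.mem_univ, true_and,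
        Finset.mem_filter, Prod.exists]
      rcases S.eq_empty_or_nonempty with rfl | ⟨x, hx⟩
      · exact ⟨none, ∅, by simp, rfl⟩
      · refine ⟨some x, S.erase x, ?_, Finset.insert_erase hx⟩
        rw [Finset.card_erase_of_mem hx]
        omega
    calc _ ≤ _ := Finset.card_le_card hsub
      _ ≤ _ := Finset.card_image_le
      _ = (Fintype.card V + 1) * (Finset.univ.filter fun S : Finset V => S.card ≤ d).card := by
        rw [Finset.card_product, Finset.card_univ, Fintype.card_option]
      _ ≤ (Fintype.card V + 1) * (Fintype.card V + 1) ^ d := by gcongr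
      _ = _ := by ring

/-- A partial concept class shattering no set of more than `d` points has a disambiguation of
quasi-polynomial size. -/
theorem exists_disambiguates_of_card_le {K V : Type*} [Fintype V] (c : K → V → Option Bool)
    (F : Set K) (d : ℕ) (hd : ∀ S, PartialShatters c F S → S.card ≤ d) :
    ∃ T : Finset (V → Bool),
      T.card ≤ (Fintype.card V + 1) ^ Nat.log 2 ((Fintype.card V + 1) ^ d) ∧
      Disambiguates c F T := by
  refine exists_disambiguates c _ F ?_
  refine lt_of_le_of_lt ?_ (Nat.lt_pow_succ_log_self one_lt_two _)
  refine (Finset.card_le_card fun S hS => ?_).trans (card_filter_card_le_le_pow V d)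
  simpa using hd S (mem_partialShatterer.1 hS)

/-- The weight of a pair of labels: the first must be `0`, and the second counts double if it
is `1`. -/
noncomputable def swapWeight (a b : Option Bool) : ℝ≥0∞ :=
  (if a = some false then 1 else 0) * (if b = some true then 2 else 1)

theorem swapWeight_le {a b : Option Bool} {p q : Bool} (ha : ∀ r, a = some r → p = r)
    (hb : ∀ r, b = some r → q = r) : swapWeight a b ≤ swapWeight (some p) (some q) := by
  unfold swapWeight
  gcongr
  · by_cases h : a = some false
    · simp [h, ha _ h]
    · simp [h]
  · by_cases h : b = some true
    · simp [h, hb _ h]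
    · rw [if_neg h]
      split_ifs <;> norm_num

theorem swapWeight_add_swap_le (p q : Bool) :
    swapWeight (some p) (some q) + swapWeight (some q) (some p) ≤ 2 := by
  cases p <;> cases q <;> norm_num [swapWeight]

/-- The supremal weight over `H` of a double sample. -/
noncomputable def supWeight {K M : Type*} (c : K → M → Option Bool) (H : Set K) {n : ℕ}
    (z : Fin n → M × M) : ℝ≥0∞ :=
  ⨆ h : H, ∏ i, swapWeight (c h (z i).1) (c h (z i).2)

/-- Exchange the two components of `z i` whenever `σ i` is true. -/
def swapBy {M : Type*} {n : ℕ} (σ : Fin n → Bool) (z : Fin n → M × M) : Fin n → M × M :=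
  fun i => (if σ i then Prod.swap else id) (z i)

/-- The `2 * n` points of a double sample. -/
def doublePoint {M : Type*} {n : ℕ} (z : Fin n → M × M) (v : Fin n × Bool) : M :=
  if v.2 then (z v.1).2 else (z v.1).1

theorem swapBy_apply {M : Type*} {n : ℕ} (σ : Fin n → Bool) (z : Fin n → M × M) (i : Fin n) :
    swapBy σ z i = (doublePoint z (i, σ i), doublePoint z (i, !σ i)) := by
  cases h : σ i <;> simp [swapBy, doublePoint, h, Prod.swap]

theorem sum_supWeight_swapBy_le {K M : Type*} (c : K → M → Option Bool) (H : Set K) {n : ℕ}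
    (z : Fin n → M × M) (T : Finset (Fin n × Bool → Bool))
    (hT : Disambiguates (fun h v => c h (doublePoint z v)) H T) :
    ∑ σ : Fin n → Bool, supWeight c H (swapBy σ z) ≤ 2 ^ n * T.card := by
  have h1 : ∀ σ : Fin n → Bool, supWeight c H (swapBy σ z) ≤
      ∑ f ∈ T, ∏ i, swapWeight (some (f (i, σ i))) (some (f (i, !σ i))) := by
    intro σ
    refine iSup_le fun h => ?_
    obtain ⟨f, hf, hag⟩ := hT h h.2
    calc ∏ i, swapWeight (c h (swapBy σ z i).1) (c h (swapBy σ z i).2)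
        ≤ ∏ i, swapWeight (some (f (i, σ i))) (some (f (i, !σ i))) := by
          refine Finset.prod_le_prod (fun _ _ => zero_le) fun i _ => ?_
          rw [swapBy_apply]
          exact swapWeight_le (hag _) (hag _)
      _ ≤ _ := Finset.single_le_sum
          (f := fun f : Fin n × Bool → Bool =>
            ∏ i, swapWeight (some (f (i, σ i))) (some (f (i, !σ i))))
          (fun _ _ => zero_le) hf
  calc ∑ σ : Fin n → Bool, supWeight c H (swapBy σ z)
      ≤ ∑ σ : Fin n → Bool, ∑ f ∈ T,
          ∏ i, swapWeight (some (f (i, σ i))) (some (f (i, !σ i))) :=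
        Finset.sum_le_sum fun σ _ => h1 σ
    _ = ∑ f ∈ T, ∏ i, ∑ b : Bool, swapWeight (some (f (i, b))) (some (f (i, !b))) := by
        rw [Finset.sum_comm]
        refine Finset.sum_congr rfl fun f _ => ?_
        rw [Finset.prod_univ_sum, Fintype.piFinset_univ]
    _ ≤ ∑ f ∈ T, 2 ^ n := by
        refine Finset.sum_le_sum fun f _ => ?_
        refine (Finset.prod_le_prod (g := fun _ => 2) (fun _ _ => zero_le) fun i _ => ?_).trans
          (by simp)
        rw [Fintype.sum_bool]
        exact swapWeight_add_swap_le _ _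
    _ = 2 ^ n * T.card := by rw [Finset.sum_const, nsmul_eq_mul, mul_comm]

theorem measurable_ite_label {M : Type*} [MeasurableSpace M] {l : M → Option Bool} {b : Bool}
    (hl : MeasurableSet {D | l D = some b}) (s t : ℝ≥0∞) :
    Measurable fun D => if l D = some b then s else t :=
  Measurable.ite hl measurable_const measurable_const

theorem measurable_supWeight {K M : Type*} [MeasurableSpace M] {c : K → M → Option Bool}
    {H : Set K} (hH : H.Countable) (hc : ∀ h ∈ H, ∀ b, MeasurableSet {D | c h D = some b})
    (n : ℕ) : Measurable (supWeight c H (n := n)) := by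
  have : Countable H := hH.to_subtype
  refine Measurable.iSup fun h => Finset.measurable_prod _ fun i _ => ?_
  exact ((measurable_ite_label (hc h h.2 false) 1 0).comp
      (measurable_fst.comp (measurable_pi_apply i))).mul
    ((measurable_ite_label (hc h h.2 true) 2 1).comp
      (measurable_snd.comp (measurable_pi_apply i)))

theorem measurePreserving_swapBy {M : Type*} [MeasurableSpace M] (P : Measure M)
    [IsProbabilityMeasure P] {n : ℕ} (σ : Fin n → Bool) :
    MeasurePreserving (swapBy σ) (Measure.pi fun _ : Fin n => P.prod P)
      (Measure.pi fun _ : Fin n => P.prod P) := by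
  refine measurePreserving_pi (f := fun i => if σ i then Prod.swap else id) _ _ fun i => ?_
  by_cases h : σ i = true
  · simpa [h] using Measure.measurePreserving_swap
  · simpa [h] using MeasurePreserving.id _

theorem lintegral_supWeight_le {K M : Type*} [MeasurableSpace M] {c : K → M → Option Bool}
    {H : Set K} (hH : H.Countable) (hc : ∀ h ∈ H, ∀ b, MeasurableSet {D | c h D = some b})
    (P : Measure M) [IsProbabilityMeasure P] {n N : ℕ}
    (hN : ∀ᵐ z ∂(Measure.pi fun _ : Fin n => P.prod P), ∃ T : Finset (Fin n × Bool → Bool),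
      T.card ≤ N ∧ Disambiguates (fun h v => c h (doublePoint z v)) H T) :
    ∫⁻ z, supWeight c H z ∂(Measure.pi fun _ : Fin n => P.prod P) ≤ N := by
  have hm := measurable_supWeight hH hc n
  have key : ∫⁻ z, ∑ σ : Fin n → Bool, supWeight c H (swapBy σ z)
      ∂(Measure.pi fun _ : Fin n => P.prod P) ≤ 2 ^ n * N := by
    calc _ ≤ ∫⁻ _, 2 ^ n * (N : ℝ≥0∞) ∂(Measure.pi fun _ : Fin n => P.prod P) := by
          refine lintegral_mono_ae ?_
          filter_upwards [hN] with z ⟨T, hTN, hT⟩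
          refine (sum_supWeight_swapBy_le c H z T hT).trans ?_
          gcongr
      _ = _ := by simp
  have hmσ : ∀ σ ∈ (Finset.univ : Finset (Fin n → Bool)),
      Measurable fun z : Fin n → M × M => supWeight c H (swapBy σ z) :=
    fun σ _ => hm.comp (measurePreserving_swapBy P σ).measurable
  rw [lintegral_finsetSum _ hmσ] at key
  simp_rw [fun σ => (measurePreserving_swapBy P σ).lintegral_comp hm] at key
  rw [Finset.sum_const, nsmul_eq_mul, Finset.card_univ, Fintype.card_fun, Fintype.card_bool,
    Fintype.card_fin] at key
  push_cast at key
  exact (ENNReal.mul_le_mul_iff_right (by simp) (by simp)).1 key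

/-- A sample on which some `h ∈ H` is constantly `0` although it takes the value `1` with
probability at least `η` is unlikely. -/
theorem measure_consistent_mul_pow_le {K M : Type*} [MeasurableSpace M]
    {c : K → M → Option Bool}
    {H : Set K} (hH : H.Countable) (hc : ∀ h ∈ H, ∀ b, MeasurableSet {D | c h D = some b})
    (P : Measure M) [IsProbabilityMeasure P] {n N : ℕ}
    (hN : ∀ᵐ z ∂(Measure.pi fun _ : Fin n => P.prod P), ∃ T : Finset (Fin n × Bool → Bool),
      T.card ≤ N ∧ Disambiguates (fun h v => c h (doublePoint z v)) H T) (η : ℝ≥0∞) :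
    (1 + η) ^ n * (Measure.pi fun _ : Fin n => P)
      {x | ∃ h ∈ H, (∀ i, c h (x i) = some false) ∧ η ≤ P {D | c h D = some true}} ≤ N := by
  have hm := measurable_supWeight hH hc n
  have hmp := measurePreserving_arrowProdEquivProdArrow M M (Fin n) (fun _ => P) (fun _ => P)
  set e := MeasurableEquiv.arrowProdEquivProdArrow M M (Fin n)
  have hm' : Measurable fun w => supWeight c H (e.symm w) := hm.comp e.symm.measurable
  have hdouble : ∫⁻ x, ∫⁻ y, supWeight c H (e.symm (x, y)) ∂(Measure.pi fun _ : Fin n => P)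
      ∂(Measure.pi fun _ : Fin n => P) ≤ N := by
    rw [← lintegral_prod _ hm'.aemeasurable, ← hmp.lintegral_comp hm']
    simpa using lintegral_supWeight_le hH hc P hN
  refine le_trans ?_ hdouble
  refine le_trans ?_ (mul_meas_ge_le_lintegral hm'.lintegral_prod_right' ((1 + η) ^ n))
  gcongr with x
  rintro ⟨h, hh, hx, hη⟩
  have hmv := measurable_ite_label (hc h hh true) 2 1
  have hone : ∫⁻ D, (if c h D = some true then 2 else 1) ∂P = 1 + P {D | c h D = some true} := by
    have : ∀ D, (if c h D = some true then (2 : ℝ≥0∞) else 1) =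
        1 + {D | c h D = some true}.indicator 1 D := by
      intro D
      by_cases hD : c h D = some true <;> simp [hD, one_add_one_eq_two]
    simp_rw [this]
    rw [lintegral_add_left measurable_const, lintegral_indicator_one (hc h hh true)]
    simp
  calc (1 + η) ^ n ≤ ∏ _i : Fin n, ∫⁻ D, (if c h D = some true then 2 else 1) ∂P := by
        rw [hone, Finset.prod_const, Finset.card_univ, Fintype.card_fin]
        gcongr
    _ = ∫⁻ y, ∏ i, (if c h (y i) = some true then 2 else 1)
          ∂(Measure.pi fun _ : Fin n => P) := by
        rw [ProbabilityTheory.lintegral_prod_eq_prod_lintegral_of_indepFun _ _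
          (ProbabilityTheory.iIndepFun_pi
            (X := fun _ D => if c h D = some true then (2 : ℝ≥0∞) else 1)
            fun i => hmv.aemeasurable) fun i => hmv.comp (measurable_pi_apply i)]
        refine Finset.prod_congr rfl fun i _ => ?_
        exact ((measurePreserving_eval (fun _ : Fin n => P) i).lintegral_comp hmv).symm
    _ ≤ _ := by
        refine lintegral_mono fun y => ?_
        refine le_trans (le_of_eq ?_) (le_iSup _ (⟨h, hh⟩ : H))
        refine Finset.prod_congr rfl fun i _ => ?_
        simp [swapWeight, e, MeasurableEquiv.arrowProdEquivProdArrow,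
          Equiv.arrowProdEquivProdArrow, hx i]

/-- The partial concept of a hypothesis on domains: `0` where its error is below `τ - α`, `1`
where its error is above `τ`, undefined elsewhere. -/
noncomputable def errLabel {X : Type*} [MeasurableSpace (X × Bool)] (τ α : ℝ) (h : X → Bool)
    (D : Measure (X × Bool)) : Option Bool :=
  if errD D h < τ - α then some false else if τ < errD D h then some true else none

theorem errLabel_eq_false {X : Type*} [MeasurableSpace (X × Bool)] {τ α : ℝ} {h : X → Bool}
    {D : Measure (X × Bool)} : errLabel τ α h D = some false ↔ errD D h < τ - α := by
  unfold errLabel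
  split_ifs <;> simp_all

theorem errLabel_eq_true {X : Type*} [MeasurableSpace (X × Bool)] {τ α : ℝ} (hα : 0 ≤ α)
    {h : X → Bool} {D : Measure (X × Bool)} : errLabel τ α h D = some true ↔ τ < errD D h := by
  unfold errLabel
  split_ifs with h1 h2
  · simp only [Option.some.injEq, Bool.false_eq_true, false_iff, not_lt]
    linarith
  · simpa using h2
  · simpa using h2

theorem measurable_errD {X : Type*} [MeasurableSpace (X × Bool)] {h : X → Bool}
    (hh : MeasurableSet {p : X × Bool | p.2 ≠ h p.1}) :
    Measurable fun D : Measure (X × Bool) => errD D h :=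
  (Measure.measurable_coe hh).ennreal_toReal

theorem measurableSet_errLabel {X : Type*} [MeasurableSpace (X × Bool)] {τ α : ℝ} (hα : 0 ≤ α)
    {h : X → Bool} (hh : MeasurableSet {p : X × Bool | p.2 ≠ h p.1}) (b : Bool) :
    MeasurableSet {D : Measure (X × Bool) | errLabel τ α h D = some b} := by
  cases b
  · simp_rw [errLabel_eq_false]
    exact measurableSet_lt (measurable_errD hh) measurable_const
  · simp_rw [errLabel_eq_true hα]
    exact measurableSet_lt measurable_const (measurable_errD hh)

/-- Index sets shattered by the error labels have at most `Gdim` elements. -/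
theorem card_le_of_partialShatters_errLabel {X V : Type*} [MeasurableSpace (X × Bool)]
    {H : Set (X → Bool)} {G : Set (Measure (X × Bool))} {τ α : ℝ} (hα : 0 ≤ α) {d : ℕ}
    (hd : Gdim H G τ α = d) {z : V → Measure (X × Bool)} (hz : ∀ v, z v ∈ G) {S : Finset V}
    (hS : PartialShatters (fun h v => errLabel τ α h (z v)) H S) : S.card ≤ d := by
  classical
  have hinj : Set.InjOn z S := by
    intro v hv w hw hvw
    by_contra hne
    obtain ⟨h, -, hg⟩ := hS fun u => decide (u = v)
    have h1 : errLabel τ α h (z v) = _ := hg v hv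
    have h2 : errLabel τ α h (z w) = _ := hg w hw
    rw [hvw] at h1
    rw [h1] at h2
    simp [Ne.symm hne] at h2
  rw [← Finset.card_image_of_injOn hinj]
  have hle : ((S.image z).card : ℕ∞) ≤ Gdim H G τ α := by
    refine le_iSup₂_of_le (S.image z) ⟨?_, ?_⟩ le_rfl
    · intro D hD
      obtain ⟨v, -, rfl⟩ := Finset.mem_image.1 hD
      exact hz v
    · intro E hE
      obtain ⟨h, hh, hg⟩ := hS fun u => !decide (z u ∈ E)
      refine ⟨h, hh, fun D hD => ?_, fun D hD => ?_⟩
      · obtain ⟨v, hv, rfl⟩ := Finset.mem_image.1 (hE hD)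
        exact errLabel_eq_false.1 (by simpa [hD] using hg v hv)
      · obtain ⟨v, hv, rfl⟩ := Finset.mem_image.1 hD.1
        exact (errLabel_eq_true hα).1 (by simpa [hD.2] using hg v hv)
  rw [hd] at hle
  exact_mod_cast hle

theorem exp_half_le_one_add {x : ℝ} (h0 : 0 ≤ x) (h1 : x ≤ 1) : Real.exp (x / 2) ≤ 1 + x := by
  have h2 : 1 - x / 2 ≤ Real.exp (-(x / 2)) := Real.one_sub_le_exp_neg _
  have h3 : Real.exp (x / 2) * Real.exp (-(x / 2)) = 1 := by rw [← Real.exp_add]; simp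
  have h4 := Real.exp_pos (x / 2)
  nlinarith [mul_le_mul_of_nonneg_left h2 h4.le, mul_nonneg h0 (sub_nonneg.2 h1)]

theorem log_disambiguation_card_le {n : ℕ} (hn : 2 ≤ n) (d : ℕ) :
    Real.log (((2 * n + 1) ^ Nat.log 2 ((2 * n + 1) ^ d) : ℕ) : ℝ) ≤
      18 * (d * Real.log n ^ 2) := by
  set L := Nat.log 2 ((2 * n + 1) ^ d)
  set l := Real.log ((2 * n + 1 : ℕ) : ℝ)
  have hl0 : 0 ≤ l := Real.log_natCast_nonneg _
  have hl : l ≤ 3 * Real.log n := by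
    have h1 : ((2 * n + 1 : ℕ) : ℝ) ≤ (n : ℝ) ^ 3 := by
      have : 2 * n + 1 ≤ n ^ 3 := by nlinarith [Nat.mul_le_mul hn hn]
      exact_mod_cast this
    have h2 := Real.log_le_log (by positivity) h1
    rwa [Real.log_pow] at h2
  have hL : (L : ℝ) * Real.log 2 ≤ d * l := by
    have h1 : (2 : ℝ) ^ L ≤ ((2 * n + 1 : ℕ) : ℝ) ^ d := by
      exact_mod_cast Nat.pow_log_le_self 2 (pow_ne_zero _ (Nat.succ_ne_zero _))
    have h2 := Real.log_le_log (by positivity) h1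
    rwa [Real.log_pow, Real.log_pow] at h2
  have hL2 : (L : ℝ) ≤ 2 * (d * l) := by
    nlinarith [Real.log_two_gt_d9, Nat.cast_nonneg (α := ℝ) L]
  rw [Nat.cast_pow, Real.log_pow]
  calc (L : ℝ) * l ≤ 2 * (d * l) * l := by gcongr
    _ = 2 * d * l ^ 2 := by ring
    _ ≤ 2 * d * (3 * Real.log n) ^ 2 := by gcongr
    _ = 18 * (d * Real.log n ^ 2) := by ring

/-- Estimates accurate up to `ε` make every min-max empirical risk minimizer have error below
`τ - α` on each sampled domain. -/
theorem errD_lt_of_minmax {X : Type*} [MeasurableSpace (X × Bool)] {H : Set (X → Bool)}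
    {τ α ε : ℝ} {n : ℕ} {Ds : Fin n → Measure (X × Bool)} {hstar : X → Bool}
    (hsH : hstar ∈ H) (hs : ∀ i, errD (Ds i) hstar ≤ τ - α - 2 * ε)
    {ehat : Fin n → (X → Bool) → ℝ} (he : ∀ i, ∀ h ∈ H, |ehat i h - errD (Ds i) h| < ε)
    {hhat : X → Bool} (hhH : hhat ∈ H)
    (hmin : ∀ h ∈ H, (⨆ i, ehat i hhat) ≤ ⨆ i, ehat i h) (i : Fin n) :
    errD (Ds i) hhat < τ - α := by
  have : Nonempty (Fin n) := ⟨i⟩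
  obtain ⟨j, hj⟩ := exists_eq_ciSup_of_finite (f := fun i => ehat i hstar)
  have h1 : ehat i hhat ≤ ⨆ i, ehat i hhat :=
    le_ciSup (f := fun i => ehat i hhat) (Set.finite_range _).bddAbove i
  have h2 := hmin hstar hsH
  have h3 := (abs_lt.1 (he i hhat hhH)).1
  have h4 := (abs_lt.1 (he j hstar hsH)).2
  have h5 := hs j
  linarith

theorem measure_badSample_le {X : Type*} [MeasurableSpace (X × Bool)]
    {H : Set (X → Bool)} {G : Set (Measure (X × Bool))} {τ α : ℝ} {d : ℕ}
    (hH : H.Countable) (hHm : ∀ h ∈ H, MeasurableSet {p : X × Bool | p.2 ≠ h p.1})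
    (hα : 0 ≤ α) (hd : Gdim H G τ α = d) {δ : ℝ} (hδ : 0 < δ) (hδ1 : δ ≤ 1) {n : ℕ} (hn : 2 ≤ n)
    {P : Measure (Measure (X × Bool))} [IsProbabilityMeasure P] (hP : ∀ᵐ D ∂P, D ∈ G)
    {η : ℝ} (hη0 : 0 ≤ η) (hη1 : η ≤ 1)
    (hη : 36 * (d * Real.log n ^ 2 + Real.log (1 / δ)) ≤ η * n) :
    (Measure.pi fun _ : Fin n => P)
      {Ds | ∃ h ∈ H, (∀ i, errD (Ds i) h < τ - α) ∧
        ENNReal.ofReal η ≤ P {D | τ < errD D h}} ≤ ENNReal.ofReal δ := by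
  set N := (2 * n + 1) ^ Nat.log 2 ((2 * n + 1) ^ d) with hNdef
  have hN : ∀ᵐ z ∂(Measure.pi fun _ : Fin n => P.prod P),
      ∃ T : Finset (Fin n × Bool → Bool), T.card ≤ N ∧
        Disambiguates (fun h v => errLabel τ α h (doublePoint z v)) H T := by
    have hfst : ∀ᵐ w ∂(P.prod P), w.1 ∈ G := Measure.quasiMeasurePreserving_fst.ae hP
    have hsnd : ∀ᵐ w ∂(P.prod P), w.2 ∈ G := Measure.quasiMeasurePreserving_snd.ae hP
    have hall : ∀ᵐ z ∂(Measure.pi fun _ : Fin n => P.prod P), ∀ i, (z i).1 ∈ G ∧ (z i).2 ∈ G :=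
      ae_all_iff.2 fun i =>
        (Measure.quasiMeasurePreserving_eval (fun _ : Fin n => P.prod P) i).ae (hfst.and hsnd)
    filter_upwards [hall] with z hz
    have hz' : ∀ v, doublePoint z v ∈ G := by
      rintro ⟨i, b⟩
      cases b
      · simpa [doublePoint] using (hz i).1
      · simpa [doublePoint] using (hz i).2
    obtain ⟨T, hT, hdis⟩ := exists_disambiguates_of_card_le
      (fun h v => errLabel τ α h (doublePoint z v)) H d
      fun S hS => card_le_of_partialShatters_errLabel hα hd hz' hS
    refine ⟨T, hT.trans_eq ?_, hdis⟩
    simp [hNdef, mul_comm]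
  have key := measure_consistent_mul_pow_le (c := errLabel τ α) hH
    (fun h hh b => measurableSet_errLabel hα (hHm h hh) b) P hN (ENNReal.ofReal η)
  simp_rw [errLabel_eq_false, errLabel_eq_true hα] at key
  have hNpos : (0 : ℝ) < N := by positivity
  have hreal : (N : ℝ) ≤ (1 + η) ^ n * δ := by
    have h1 : Real.log N ≤ 18 * (d * Real.log n ^ 2) := log_disambiguation_card_le hn d
    have h2 : 0 ≤ Real.log (1 / δ) := Real.log_nonneg (by rw [le_div_iff₀ hδ]; linarith)
    have h3 : Real.log N + Real.log (1 / δ) ≤ n * (η / 2) := by linarith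
    have h4 : (N : ℝ) * (1 / δ) ≤ (1 + η) ^ n := by
      calc (N : ℝ) * (1 / δ) = Real.exp (Real.log N + Real.log (1 / δ)) := by
            rw [Real.exp_add, Real.exp_log hNpos, Real.exp_log (by positivity)]
        _ ≤ Real.exp (n * (η / 2)) := Real.exp_le_exp.2 h3
        _ = Real.exp (η / 2) ^ n := Real.exp_nat_mul _ _
        _ ≤ (1 + η) ^ n := by
            gcongr
            exact exp_half_le_one_add hη0 hη1
    rwa [mul_one_div, div_le_iff₀ hδ] at h4
  have hENN : (N : ℝ≥0∞) ≤ (1 + ENNReal.ofReal η) ^ n * ENNReal.ofReal δ := by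
    rw [← ENNReal.ofReal_one, ← ENNReal.ofReal_add zero_le_one hη0,
      ← ENNReal.ofReal_pow (by positivity), ← ENNReal.ofReal_mul (by positivity),
      ← ENNReal.ofReal_natCast]
    exact ENNReal.ofReal_le_ofReal hreal
  refine (ENNReal.mul_le_mul_iff_right ?_ ?_).1 (key.trans hENN)
  · exact pow_ne_zero _ (by simp)
  · exact ENNReal.pow_ne_top (by simp)

/-- Theorem 4.2, upper bound for min-max ERM: there is an absolute
constant `C > 0` such that for any countable hypothesis class `H`, domain family `G`
with `Gdim(H,G,τ,α) = d`, any `ε, δ ∈ (0,1/2)`, `n ≥ 2`, and any distribution `P` over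
`G` admitting `h* ∈ H` with `err_D(h*) ≤ τ - α - 2ε` for `P`-a.e. `D`, with probability
at least `1 - δ` over `n` i.i.d. domains from `P`: for every collection of estimates
`ê_i(h)` that are `ε`-accurate on all `h ∈ H`, every minimizer `ĥ ∈ H` of
`max_i ê_i(h)` satisfies `Pr_{D∼P}[err_D(ĥ) > τ] ≤ C (d log² n + log(1/δ)) / n`. -/
theorem minmax_erm_domain_generalization :
    ∃ C : ℝ, 0 < C ∧
    ∀ (X : Type) [MeasurableSpace (X × Bool)]
      (H : Set (X → Bool)) (G : Set (Measure (X × Bool))) (τ α : ℝ) (d : ℕ),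
      H.Countable →
      (∀ h ∈ H, MeasurableSet {p : X × Bool | p.2 ≠ h p.1}) →
      (∀ D ∈ G, IsProbabilityMeasure D) →
      τ ∈ Set.Icc (0:ℝ) 1 → α ∈ Set.Icc (0:ℝ) 1 →
      Gdim H G τ α = (d : ℕ∞) →
      ∀ ε δ : ℝ, ε ∈ Set.Ioo (0:ℝ) (1/2) → δ ∈ Set.Ioo (0:ℝ) (1/2) →
      ∀ n : ℕ, 2 ≤ n →
      ∀ P : Measure (Measure (X × Bool)), IsProbabilityMeasure P →
      (∀ᵐ D ∂P, D ∈ G) →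
      (∃ hstar ∈ H, ∀ᵐ D ∂P, errD D hstar ≤ τ - α - 2 * ε) →
      ENNReal.ofReal (1 - δ) ≤
        (Measure.pi fun _ : Fin n => P)
          {Ds : Fin n → Measure (X × Bool) |
            ∀ ehat : Fin n → (X → Bool) → ℝ,
              (∀ i, ∀ h ∈ H, |ehat i h - errD (Ds i) h| < ε) →
              ∀ hhat ∈ H, (∀ h ∈ H, (⨆ i, ehat i hhat) ≤ ⨆ i, ehat i h) →
                (P {D | τ < errD D hhat}).toReal ≤
                  C * ((d : ℝ) * (Real.log n) ^ 2 + Real.log (1 / δ)) / n} := by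
  refine ⟨36, by norm_num, ?_⟩
  intro X _ H G τ α d hH hHm _ _ hα hd ε δ _ hδ n hn P _ hP ⟨hstar, hsH, hs⟩
  set A := {Ds : Fin n → Measure (X × Bool) |
            ∀ ehat : Fin n → (X → Bool) → ℝ,
              (∀ i, ∀ h ∈ H, |ehat i h - errD (Ds i) h| < ε) →
              ∀ hhat ∈ H, (∀ h ∈ H, (⨆ i, ehat i hhat) ≤ ⨆ i, ehat i h) →
                (P {D | τ < errD D hhat}).toReal ≤
                  36 * ((d : ℝ) * (Real.log n) ^ 2 + Real.log (1 / δ)) / n}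
  have hn0 : (0 : ℝ) < n := by positivity
  set η := 36 * ((d : ℝ) * (Real.log n) ^ 2 + Real.log (1 / δ)) / n with hηdef
  have hlogδ : 0 ≤ Real.log (1 / δ) :=
    Real.log_nonneg (by rw [le_div_iff₀ hδ.1]; linarith [hδ.2])
  have hη0 : 0 ≤ η := by positivity
  suffices hA : (Measure.pi fun _ : Fin n => P) Aᶜ ≤ ENNReal.ofReal δ by
    have h1 : 1 ≤ (Measure.pi fun _ : Fin n => P) A + ENNReal.ofReal δ := by
      calc (1 : ℝ≥0∞) = (Measure.pi fun _ : Fin n => P) (A ∪ Aᶜ) := by simp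
        _ ≤ _ := measure_union_le _ _
        _ ≤ _ := by gcongr
    rw [ENNReal.ofReal_sub _ hδ.1.le, ENNReal.ofReal_one]
    exact tsub_le_iff_right.2 h1
  rcases le_or_gt η 1 with hη1 | hη1
  · refine le_trans (measure_mono_ae ?_)
      (measure_badSample_le hH hHm hα.1 hd hδ.1 (by linarith [hδ.2]) hn hP hη0 hη1
        (by rw [hηdef, div_mul_cancel₀ _ hn0.ne']))
    have hall : ∀ᵐ Ds ∂(Measure.pi fun _ : Fin n => P),
        ∀ i, errD (Ds i) hstar ≤ τ - α - 2 * ε :=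
      ae_all_iff.2 fun i => (Measure.quasiMeasurePreserving_eval (fun _ : Fin n => P) i).ae hs
    filter_upwards [hall] with Ds hDs hbad
    have hbad' : ¬ Ds ∈ A := hbad
    simp only [A, Set.mem_ofPred_eq, not_forall, not_le] at hbad'
    obtain ⟨ehat, he, hhat, hhH, hmin, hgt⟩ := hbad'
    exact ⟨hhat, hhH, errD_lt_of_minmax hsH hDs he hhH hmin,
      (ENNReal.ofReal_lt_iff_lt_toReal hη0 (measure_ne_top _ _)).2 hgt |>.le⟩
  · have : Aᶜ = ∅ := by
      rw [Set.compl_empty_iff, Set.eq_univ_iff_forall]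
      intro Ds ehat _ hhat _ _
      exact measureReal_le_one.trans hη1.le
    simp [this]
end

section
/- There exists an absolute constant C > 0 with the following property (quasipolynomial Sauer–Shelah–Perles lemma for disambiguations of partial concepts). Let F be a class of partial concepts f : Z → {0,1,⊥} on an arbitrary set Z with VCdim(F) = d finite, and let S ⊆ Z be a finite set of size n > 1. Then there exists a class F̄ of total functions f̄ : S → {0,1} with |F̄| ≤ n^{C·d·log n} such that for every f ∈ F there exists f̄ ∈ F̄ with f̄(s) = f(s) for every s ∈ S with f(s) ∈ {0,1}. -/
/-- A finite set `S` is shattered by a class `F` of partial concepts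
`f : Z → {0,1,⊥}` (encoded as `Z → Option Bool`, with `⊥ = none`). -/
def PShatters {Z : Type*} (F : Set (Z → Option Bool)) (S : Finset Z) : Prop :=
  ∀ E ⊆ S, ∃ f ∈ F, (∀ s ∈ E, f s = some false) ∧ ∀ s ∈ S, s ∉ E → f s = some true

/-- The VC dimension of a class of partial concepts. -/
noncomputable def PVCdim {Z : Type*} (F : Set (Z → Option Bool)) : ℕ∞ :=
  ⨆ (S : Finset Z) (_ : PShatters F S), (S.card : ℕ∞)

/-- The subclass of concepts taking the defined value `b` at `x`. -/
def labelSubclass {Z : Type*} (F : Set (Z → Option Bool)) (x : Z) (b : Bool) :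
    Set (Z → Option Bool) :=
  {f ∈ F | f x = some b}

open Classical in
/-- The family of subsets of `S` shattered by `F`. -/
noncomputable def shatteredSubsets {Z : Type*} (F : Set (Z → Option Bool)) (S : Finset Z) :
    Finset (Finset Z) :=
  S.powerset.filter (PShatters F)

theorem mem_shatteredSubsets {Z : Type*} {F : Set (Z → Option Bool)} {S A : Finset Z} :
    A ∈ shatteredSubsets F S ↔ A ⊆ S ∧ PShatters F A := by
  simp [shatteredSubsets]

theorem PShatters.mono {Z : Type*} {F G : Set (Z → Option Bool)} {A : Finset Z}
    (h : PShatters F A) (hFG : F ⊆ G) : PShatters G A := fun E hE =>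
  let ⟨f, hf, hE⟩ := h E hE
  ⟨f, hFG hf, hE⟩

theorem PShatters.notMem_of_labelSubclass {Z : Type*} {F : Set (Z → Option Bool)} {A : Finset Z}
    {x : Z} {b : Bool} (h : PShatters (labelSubclass F x b) A) : x ∉ A := by
  intro hx
  obtain ⟨f, hf, hf0, -⟩ := h A subset_rfl
  obtain ⟨g, hg, -, hg1⟩ := h ∅ (Finset.empty_subset A)
  have h0 := hf.2.symm.trans (hf0 x hx)
  have h1 := hg.2.symm.trans (hg1 x hx (Finset.notMem_empty x))
  simp_all

open Classical in
theorem PShatters.insert {Z : Type*} {F : Set (Z → Option Bool)} {A : Finset Z} {x : Z}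
    (h0 : PShatters (labelSubclass F x false) A) (h1 : PShatters (labelSubclass F x true) A) :
    PShatters F (insert x A) := by
  have hxA := h0.notMem_of_labelSubclass
  intro E hE
  by_cases hx : x ∈ E
  · obtain ⟨f, hf, hf0, hf1⟩ := h0 (E.erase x) (Finset.subset_insert_iff.1 hE)
    refine ⟨f, hf.1, fun s hs => ?_, fun s hs hsE => ?_⟩
    · by_cases hsx : s = x
      · exact hsx ▸ hf.2
      · exact hf0 s (Finset.mem_erase.2 ⟨hsx, hs⟩)
    · have hsx : s ≠ x := fun h => hsE (h ▸ hx)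
      exact hf1 s (Finset.mem_of_mem_insert_of_ne hs hsx) fun h => hsE (Finset.mem_of_mem_erase h)
  · obtain ⟨f, hf, hf0, hf1⟩ := h1 E ((Finset.subset_insert_iff_of_notMem hx).1 hE)
    refine ⟨f, hf.1, hf0, fun s hs hsE => ?_⟩
    by_cases hsx : s = x
    · exact hsx ▸ hf.2
    · exact hf1 s (Finset.mem_of_mem_insert_of_ne hs hsx) hsE

theorem card_shatteredSubsets_labelSubclass_add_le {Z : Type*} (F : Set (Z → Option Bool))
    (S : Finset Z) {x : Z} (hx : x ∈ S) :
    (shatteredSubsets (labelSubclass F x false) S).card +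
      (shatteredSubsets (labelSubclass F x true) S).card ≤ (shatteredSubsets F S).card := by
  classical
  set P := shatteredSubsets (labelSubclass F x false) S
  set Q := shatteredSubsets (labelSubclass F x true) S
  have hPx : ∀ A ∈ P, x ∉ A := fun A hA =>
    (mem_shatteredSubsets.1 hA).2.notMem_of_labelSubclass
  have hQx : ∀ A ∈ Q, x ∉ A := fun A hA =>
    (mem_shatteredSubsets.1 hA).2.notMem_of_labelSubclass
  have hinj : Set.InjOn (insert x : Finset Z → Finset Z) (P ∩ Q : Finset (Finset Z)) := by
    intro A hA B hB hAB
    rw [← Finset.erase_insert (hPx A (Finset.mem_inter.1 hA).1),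
      ← Finset.erase_insert (hPx B (Finset.mem_inter.1 hB).1)]
    exact congrArg (fun C => C.erase x) hAB
  have hdisj : Disjoint (P ∪ Q) ((P ∩ Q).image (insert x)) := by
    rw [Finset.disjoint_right]
    intro B hB hBPQ
    obtain ⟨A, -, rfl⟩ := Finset.mem_image.1 hB
    have hxA := Finset.mem_insert_self x A
    exact (Finset.mem_union.1 hBPQ).elim (fun h => hPx _ h hxA) fun h => hQx _ h hxA
  rw [← Finset.card_union_add_card_inter, ← Finset.card_image_of_injOn hinj,
    ← Finset.card_union_of_disjoint hdisj]
  refine Finset.card_le_card fun B hB => mem_shatteredSubsets.2 ?_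
  rcases Finset.mem_union.1 hB with hB | hB
  · rcases Finset.mem_union.1 hB with hB | hB
    all_goals
      obtain ⟨hBS, hB⟩ := mem_shatteredSubsets.1 hB
      exact ⟨hBS, hB.mono (Set.sep_subset _ _)⟩
  · obtain ⟨A, hA, rfl⟩ := Finset.mem_image.1 hB
    obtain ⟨hA0, hA1⟩ := Finset.mem_inter.1 hA
    obtain ⟨hAS, hA0⟩ := mem_shatteredSubsets.1 hA0
    exact ⟨Finset.insert_subset hx hAS, hA0.insert (mem_shatteredSubsets.1 hA1).2⟩

theorem exists_two_mul_card_shatteredSubsets_labelSubclass_le {Z : Type*}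
    (F : Set (Z → Option Bool)) (S : Finset Z) :
    ∃ h : {z // z ∈ S} → Bool, ∀ x : {z // z ∈ S},
      2 * (shatteredSubsets (labelSubclass F x.1 (!h x)) S).card ≤
        (shatteredSubsets F S).card := by
  refine ⟨fun x => decide ((shatteredSubsets (labelSubclass F x.1 false) S).card ≤
    (shatteredSubsets (labelSubclass F x.1 true) S).card), fun x => ?_⟩
  have hadd := card_shatteredSubsets_labelSubclass_add_le F S x.2
  by_cases hle : (shatteredSubsets (labelSubclass F x.1 false) S).card ≤
      (shatteredSubsets (labelSubclass F x.1 true) S).card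
  · simp only [hle, decide_true, Bool.not_true]
    omega
  · simp only [hle, decide_false, Bool.not_false]
    omega

theorem card_shatteredSubsets_pos {Z : Type*} {F : Set (Z → Option Bool)} (hF : F.Nonempty)
    (S : Finset Z) : 0 < (shatteredSubsets F S).card := by
  obtain ⟨f, hf⟩ := hF
  refine Finset.card_pos.2 ⟨∅, mem_shatteredSubsets.2 ⟨Finset.empty_subset S, fun E hE => ?_⟩⟩
  rw [Finset.subset_empty.1 hE]
  exact ⟨f, hf, by simp, by simp⟩

theorem exists_disambiguation_of_card_shatteredSubsets_lt {Z : Type*} (S : Finset Z)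
    (hS : 1 < S.card) (k : ℕ) (F : Set (Z → Option Bool))
    (hF : (shatteredSubsets F S).card < 2 ^ (k + 1)) :
    ∃ G : Finset ({z // z ∈ S} → Bool), G.card + 1 ≤ 2 * S.card ^ k ∧
      ∀ f ∈ F, ∃ g ∈ G, ∀ (z : {z // z ∈ S}) (b : Bool), f z.1 = some b → g z = b := by
  classical
  induction k generalizing F with
  | zero =>
    obtain ⟨h, hh⟩ := exists_two_mul_card_shatteredSubsets_labelSubclass_le F S
    refine ⟨{h}, by simp, fun f hf => ⟨h, Finset.mem_singleton_self h, fun z b hz => ?_⟩⟩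
    by_contra hne
    have hb : (!h z) = b := by cases b <;> cases hz : h z <;> simp_all
    have hpos := card_shatteredSubsets_pos (F := labelSubclass F z.1 (!h z))
      ⟨f, hf, hb ▸ hz⟩ S
    have := hh z
    omega
  | succ k ih =>
    obtain ⟨h, hh⟩ := exists_two_mul_card_shatteredSubsets_labelSubclass_le F S
    choose G hGcard hG using fun x : {z // z ∈ S} =>
      ih (labelSubclass F x.1 (!h x)) (by have := hh x; rw [pow_succ] at hF; omega)
    refine ⟨insert h (Finset.univ.biUnion G), ?_, fun f hf => ?_⟩
    · have hunion : (Finset.univ.biUnion G).card ≤ S.card * (2 * S.card ^ k - 1) := by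
        refine (Finset.card_biUnion_le_card_mul _ _ (2 * S.card ^ k - 1) fun x _ => ?_).trans ?_
        · have := hGcard x
          omega
        · simp
      have hinsert := Finset.card_insert_le h (Finset.univ.biUnion G)
      have hmul : S.card * (2 * S.card ^ k - 1) + S.card = 2 * S.card ^ (k + 1) := by
        have hpos : 1 ≤ 2 * S.card ^ k := by
          have : 0 < S.card ^ k := Nat.pow_pos (by omega)
          omega
        obtain ⟨m, hm⟩ := Nat.exists_eq_add_of_le' hpos
        rw [pow_succ, ← mul_assoc, hm, Nat.add_sub_cancel]
        ring
      omega
    · by_cases hagree : ∀ (z : {z // z ∈ S}) (b : Bool), f z.1 = some b → h z = b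
      · exact ⟨h, Finset.mem_insert_self _ _, hagree⟩
      · push Not at hagree
        obtain ⟨z, b, hz, hne⟩ := hagree
        have hb : (!h z) = b := by cases b <;> cases hz : h z <;> simp_all
        obtain ⟨g, hg, hgf⟩ := hG z f ⟨hf, hb ▸ hz⟩
        exact ⟨g, Finset.mem_insert_of_mem (Finset.mem_biUnion.2 ⟨z, Finset.mem_univ z, hg⟩), hgf⟩

theorem card_shatteredSubsets_le {Z : Type*} {F : Set (Z → Option Bool)} {d : ℕ}
    (hF : PVCdim F ≤ d) (S : Finset Z) :
    (shatteredSubsets F S).card ≤ ∑ i ∈ Finset.range (d + 1), S.card.choose i := by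
  classical
  have hsub : shatteredSubsets F S ⊆ (Finset.range (d + 1)).biUnion S.powersetCard := by
    intro A hA
    obtain ⟨hAS, hA⟩ := mem_shatteredSubsets.1 hA
    have hcard : (A.card : ℕ∞) ≤ d := (le_iSup₂_of_le A hA le_rfl).trans hF
    have hcard : A.card ≤ d := by exact_mod_cast hcard
    exact Finset.mem_biUnion.2 ⟨A.card, Finset.mem_range.2 (by omega),
      Finset.mem_powersetCard.2 ⟨hAS, rfl⟩⟩
  refine (Finset.card_le_card hsub).trans (Finset.card_biUnion_le.trans ?_)
  simp [Finset.card_powersetCard]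

theorem sum_range_choose_lt_pow {n : ℕ} (hn : 2 ≤ n) (d : ℕ) :
    ∑ i ∈ Finset.range (d + 1), n.choose i < n ^ (d + 1) :=
  (Finset.sum_le_sum fun i _ => Nat.choose_le_pow n i).trans_lt
    (Nat.geomSum_lt hn fun _ hk => Finset.mem_range.1 hk)

/-- Theorem 4.4, quasipolynomial Sauer–Shelah–Perles lemma for
disambiguations of partial concepts: there is an absolute constant `C > 0` such that
for every class `F` of partial concepts with `VCdim(F) = d` and every finite `S ⊆ Z`
of size `n > 1`, there is a class `F̄` of total functions `S → {0,1}` with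
`|F̄| ≤ n^(C·d·log n)` such that every `f ∈ F` is disambiguated on `S` by some
`f̄ ∈ F̄`. -/
theorem quasipolynomial_sauer_shelah_perles :
    ∃ C : ℝ, 0 < C ∧
    ∀ (Z : Type) (F : Set (Z → Option Bool)) (d : ℕ),
      PVCdim F = (d : ℕ∞) →
      ∀ S : Finset Z, 1 < S.card →
      ∃ Fbar : Finset ({z // z ∈ S} → Bool),
        (Fbar.card : ℝ) ≤ (S.card : ℝ) ^ (C * d * Real.log S.card) ∧
        ∀ f ∈ F, ∃ g ∈ Fbar, ∀ (z : {z // z ∈ S}) (b : Bool),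
          f z.1 = some b → g z = b := by
  refine ⟨3 / Real.log 2, by positivity, fun Z F d hd S hS => ?_⟩
  have hsh := card_shatteredSubsets_le hd.le S
  obtain rfl | hd0 := Nat.eq_zero_or_pos d
  · obtain ⟨G, hG, hFG⟩ := exists_disambiguation_of_card_shatteredSubsets_lt S hS 0 F
      (hsh.trans_lt (by simp))
    have hG : G.card ≤ 1 := by simpa using hG
    exact ⟨G, by simpa using hG, hFG⟩
  · obtain ⟨G, hG, hFG⟩ := exists_disambiguation_of_card_shatteredSubsets_lt S hS
      (Nat.log 2 (S.card ^ (2 * d))) F (by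
        refine (hsh.trans_lt (sum_range_choose_lt_pow hS d)).trans_le ?_
        exact (Nat.pow_le_pow_right (by omega) (by omega)).trans
          (Nat.lt_pow_succ_log_self one_lt_two _).le)
    refine ⟨G, ?_, hFG⟩
    set k := Nat.log 2 (S.card ^ (2 * d))
    have hcard : G.card ≤ S.card ^ (k + 1) := by
      rw [pow_succ']
      exact (Nat.le_of_succ_le hG).trans (Nat.mul_le_mul_right _ hS)
    have hn : (2 : ℝ) ≤ S.card := by exact_mod_cast hS
    have hlog2 : 0 < Real.log 2 := Real.log_pos one_lt_two
    have hlogn : Real.log 2 ≤ Real.log S.card := Real.log_le_log two_pos hn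
    have hd1 : (1 : ℝ) ≤ d := by exact_mod_cast hd0
    have hpow : (2 : ℝ) ^ k ≤ (S.card : ℝ) ^ (2 * d) := by
      exact_mod_cast Nat.pow_log_le_self 2 (pow_pos (by omega) (2 * d)).ne'
    have hklog : k * Real.log 2 ≤ 2 * d * Real.log S.card := by
      have := Real.log_le_log (by positivity) hpow
      rw [Real.log_pow, Real.log_pow] at this
      exact_mod_cast this
    calc (G.card : ℝ) ≤ (S.card : ℝ) ^ (k + 1) := by exact_mod_cast hcard
      _ = (S.card : ℝ) ^ ((k + 1 : ℕ) : ℝ) := (Real.rpow_natCast _ _).symm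
      _ ≤ _ := by
        refine Real.rpow_le_rpow_of_exponent_le (by linarith) ?_
        rw [div_mul_eq_mul_div, div_mul_eq_mul_div, le_div_iff₀ hlog2]
        push_cast
        nlinarith
end

section
/- Let H be a class of hypotheses h : X → {0,1} and G a family of domains, and assume Gdim(H, G, τ, α) = d for some 0 ≤ α < τ ≤ 1/2 and positive integer d. Let D_0 be a distribution on X × {0,1} with err_{D_0}(h) = 0 for every h ∈ H, let D_1, …, D_d ∈ G be d domains α-shattered by H at τ, set λ := (τ − α)/(1 − τ) ∈ (0,1], and for each i ∈ [d] define D'_i := (1 − λ)·D_0 + λ·(¬D_i), where ¬D_i is the distribution of (x, ¬y) for (x,y) ∼ D_i. Then for G' := G ∪ {D_0, D'_1, …, D'_d} we have Gdim(H, G', τ, α) = d. -/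
open MeasureTheory
open scoped ENNReal

/-- The label-flipped domain `¬D`: pushforward of `D` under `(x, y) ↦ (x, ¬y)`. -/
noncomputable def negD {X : Type*} [MeasurableSpace (X × Bool)]
    (D : Measure (X × Bool)) : Measure (X × Bool) :=
  D.map (fun p => (p.1, !p.2))

/-- The mixture `(1 - λ)·D₀ + λ·D`. -/
noncomputable def mixD {X : Type*} [MeasurableSpace (X × Bool)] (lam : ℝ)
    (D0 D : Measure (X × Bool)) : Measure (X × Bool) :=
  ENNReal.ofReal (1 - lam) • D0 + ENNReal.ofReal lam • D

/-- Every hypothesis of `H` with low error on `D` has high error on `D'`, and vice versa. -/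
def FlipsError {X : Type*} [MeasurableSpace (X × Bool)]
    (H : Set (X → Bool)) (τ α : ℝ) (D D' : Measure (X × Bool)) : Prop :=
  ∀ h ∈ H, (errD D h < τ - α → τ < errD D' h) ∧ (τ < errD D h → errD D' h < τ - α)

lemma AlphaShattered.injOn_of_fixes_or_flips {X : Type*} [MeasurableSpace (X × Bool)]
    {H : Set (X → Bool)} {S : Set (Measure (X × Bool))} {τ α : ℝ} (hα : 0 ≤ α)
    (hS : AlphaShattered H S τ α) {φ : Measure (X × Bool) → Measure (X × Bool)}
    (hφ : ∀ D ∈ S, φ D = D ∨ FlipsError H τ α D (φ D)) : Set.InjOn φ S := by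
  intro D hD D' hD' hEq
  by_contra hne
  obtain ⟨h, hH, -, hhigh⟩ := hS ∅ (Set.empty_subset S)
  have high₁ := hhigh D ⟨hD, id⟩
  have high₂ := hhigh D' ⟨hD', id⟩
  rcases hφ D hD with h₁ | h₁ <;> rcases hφ D' hD' with h₂ | h₂
  · exact hne (h₁.symm.trans (hEq.trans h₂))
  · have := (h₂ h hH).2 high₂
    rw [← hEq, h₁] at this
    linarith
  · have := (h₁ h hH).2 high₁
    rw [hEq, h₂] at this
    linarith
  · obtain ⟨g, gH, glow, ghigh⟩ := hS {D} (Set.singleton_subset_iff.2 hD)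
    have a := (h₁ g gH).1 (glow D rfl)
    have b := (h₂ g gH).2 (ghigh D' ⟨hD', fun e => hne e.symm⟩)
    rw [hEq] at a
    linarith

lemma AlphaShattered.image_of_fixes_or_flips {X : Type*} [MeasurableSpace (X × Bool)]
    {H : Set (X → Bool)} {S : Set (Measure (X × Bool))} {τ α : ℝ}
    (hS : AlphaShattered H S τ α) {φ : Measure (X × Bool) → Measure (X × Bool)}
    (hφ : ∀ D ∈ S, φ D = D ∨ FlipsError H τ α D (φ D)) :
    AlphaShattered H (φ '' S) τ α := by
  intro E hE
  obtain ⟨h, hH, hlow, hhigh⟩ :=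
    hS {D ∈ S | (φ D = D ∧ φ D ∈ E) ∨ (φ D ≠ D ∧ φ D ∉ E)} (Set.sep_subset _ _)
  refine ⟨h, hH, ?_, ?_⟩
  · intro D' hD'
    obtain ⟨D, hD, rfl⟩ := hE hD'
    by_cases hfix : φ D = D
    · rw [hfix]
      exact hlow D ⟨hD, Or.inl ⟨hfix, hD'⟩⟩
    · exact (((hφ D hD).resolve_left hfix) h hH).2 (hhigh D ⟨hD, by simp [hfix, hD']⟩)
  · rintro _ ⟨⟨D, hD, rfl⟩, hD'⟩
    by_cases hfix : φ D = D
    · rw [hfix]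
      exact hhigh D ⟨hD, fun hm => hm.2.elim (fun a => hD' a.2) fun a => a.1 hfix⟩
    · exact (((hφ D hD).resolve_left hfix) h hH).1 (hlow D ⟨hD, Or.inr ⟨hfix, hD'⟩⟩)

lemma errD_mixD {X : Type*} [MeasurableSpace (X × Bool)] {lam : ℝ} (h0 : 0 ≤ lam)
    (h1 : lam ≤ 1) (D₀ D : Measure (X × Bool)) [IsFiniteMeasure D₀] [IsFiniteMeasure D]
    (h : X → Bool) :
    errD (mixD lam D₀ D) h = (1 - lam) * errD D₀ h + lam * errD D h := by
  unfold errD mixD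
  rw [Measure.add_apply, Measure.smul_apply, Measure.smul_apply, smul_eq_mul, smul_eq_mul,
    ENNReal.toReal_add (by finiteness) (by finiteness), ENNReal.toReal_mul, ENNReal.toReal_mul,
    ENNReal.toReal_ofReal (by linarith), ENNReal.toReal_ofReal h0]

lemma errD_negD {X : Type*} [MeasurableSpace (X × Bool)] (D : Measure (X × Bool))
    [IsProbabilityMeasure D] (hf : AEMeasurable (fun p : X × Bool => (p.1, !p.2)) D)
    {h : X → Bool} (hh : MeasurableSet {p : X × Bool | p.2 ≠ h p.1}) :
    errD (negD D) h = 1 - errD D h := by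
  have hpre : (fun p : X × Bool => (p.1, !p.2)) ⁻¹' {p : X × Bool | p.2 ≠ h p.1}
      = {p : X × Bool | p.2 ≠ h p.1}ᶜ := by
    ext p
    simp
  unfold errD negD
  rw [Measure.map_apply_of_aemeasurable hf hh, hpre]
  exact probReal_compl_eq_one_sub hh

/-- When label flipping is not a.e. measurable for `D`, Mathlib's pushforward is `0`. -/
lemma negD_of_not_aemeasurable {X : Type*} [MeasurableSpace (X × Bool)]
    {D : Measure (X × Bool)} (hf : ¬ AEMeasurable (fun p : X × Bool => (p.1, !p.2)) D) :
    negD D = 0 :=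
  Measure.map_of_not_aemeasurable hf

lemma flipsError_mixD_negD {X : Type*} [MeasurableSpace (X × Bool)] {H : Set (X → Bool)}
    {τ α : ℝ} (hα : 0 ≤ α) (hατ : α < τ) (hτ : τ ≤ 1 / 2)
    (hHmeas : ∀ h ∈ H, MeasurableSet {p : X × Bool | p.2 ≠ h p.1})
    {D₀ D : Measure (X × Bool)} [IsFiniteMeasure D₀] [IsProbabilityMeasure D]
    (hD₀ : ∀ h ∈ H, errD D₀ h = 0)
    (hhigh : ∃ h ∈ H, τ < errD (mixD ((τ - α) / (1 - τ)) D₀ (negD D)) h) :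
    FlipsError H τ α (mixD ((τ - α) / (1 - τ)) D₀ (negD D)) D := by
  have hτ1 : 0 < 1 - τ := by linarith
  have hl0 : 0 ≤ (τ - α) / (1 - τ) := div_nonneg (by linarith) hτ1.le
  have hl1 : (τ - α) / (1 - τ) ≤ 1 := (div_le_one hτ1).2 (by linarith)
  by_cases hf : AEMeasurable (fun p : X × Bool => (p.1, !p.2)) D
  · intro h hH
    have : IsFiniteMeasure (negD D) := by unfold negD; infer_instance
    rw [errD_mixD hl0 hl1, hD₀ h hH, errD_negD D hf (hHmeas h hH), mul_zero, zero_add,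
      div_mul_eq_mul_div, div_lt_iff₀ hτ1, lt_div_iff₀ hτ1]
    have ht : 0 < τ - α := by linarith
    constructor
    · intro hlt
      have := lt_of_mul_lt_mul_left hlt ht.le
      linarith
    · intro hlt
      have key : (τ - α) * (1 - (τ - α)) ≤ τ * (1 - τ) := by nlinarith
      have := lt_of_mul_lt_mul_left (key.trans_lt hlt) ht.le
      linarith
  · obtain ⟨h, hH, hh⟩ := hhigh
    rw [negD_of_not_aemeasurable hf, errD_mixD hl0 hl1, hD₀ h hH] at hh
    simp only [errD, Measure.coe_zero, Pi.zero_apply, ENNReal.toReal_zero, mul_zero,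
      add_zero] at hh
    linarith

/-- first part of Theorem 4.6: if `Gdim(H, G, τ, α) = d` with
`0 ≤ α < τ ≤ 1/2`, `D₀` is a domain on which every `h ∈ H` has zero error,
`D_1, …, D_d ∈ G` are shattered by `H`, `λ := (τ-α)/(1-τ)`, and
`D'_i := (1-λ)·D₀ + λ·(¬D_i)`, then for `G' := G ∪ {D₀, D'_1, …, D'_d}` we still have
`Gdim(H, G', τ, α) = d`. -/
theorem gdim_extended_family {X : Type*} [MeasurableSpace (X × Bool)]
    (H : Set (X → Bool)) (G : Set (Measure (X × Bool)))
    (τ α : ℝ) (d : ℕ) (hd : 0 < d)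
    (hα : 0 ≤ α) (hατ : α < τ) (hτ : τ ≤ 1 / 2)
    (hHmeas : ∀ h ∈ H, MeasurableSet {p : X × Bool | p.2 ≠ h p.1})
    (hGprob : ∀ D ∈ G, IsProbabilityMeasure D)
    (hGdim : Gdim H G τ α = (d : ℕ∞))
    (D0 : Measure (X × Bool)) [IsProbabilityMeasure D0]
    (hD0 : ∀ h ∈ H, errD D0 h = 0)
    (Ds : Fin d → Measure (X × Bool))
    (hDsG : ∀ i, Ds i ∈ G) (hinj : Function.Injective Ds)
    (hshat : AlphaShattered H (Set.range Ds) τ α) :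
    Gdim H
      (G ∪ {D0} ∪ Set.range (fun i => mixD ((τ - α) / (1 - τ)) D0 (negD (Ds i))))
      τ α = (d : ℕ∞) := by
  classical
  refine le_antisymm ?_ ?_
  · refine iSup₂_le fun S ⟨hSG, hS⟩ => ?_
    obtain ⟨g, gH, -, ghigh⟩ := hS ∅ (Set.empty_subset _)
    have hφ : ∀ D ∈ S, ∃ D' ∈ G, D' = D ∨ FlipsError H τ α D D' := by
      intro D hD
      have hg := ghigh D ⟨hD, id⟩
      rcases hSG hD with (hDG | rfl) | ⟨i, rfl⟩
      · exact ⟨D, hDG, Or.inl rfl⟩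
      · rw [hD0 g gH] at hg
        linarith
      · have := hGprob _ (hDsG i)
        exact ⟨Ds i, hDsG i, Or.inr
          (flipsError_mixD_negD hα hατ hτ hHmeas hD0 ⟨g, gH, hg⟩)⟩
    choose! φ hφG hφS using hφ
    rw [← hGdim, ← Finset.card_image_of_injOn (hS.injOn_of_fixes_or_flips hα hφS)]
    refine le_iSup₂_of_le (S.image φ) ⟨?_, ?_⟩ le_rfl
    · simpa [Set.subset_def] using hφG
    · rw [Finset.coe_image]
      exact hS.image_of_fixes_or_flips hφS
  · rw [← hGdim]
    exact iSup₂_le fun S ⟨hSG, hS⟩ => le_iSup₂_of_le S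
      ⟨fun D hD => Or.inl (Or.inl (hSG hD)), hS⟩ le_rfl
end

section
/- There exists an absolute constant c > 0 such that for every positive integer d there exists a set X and a hypothesis class H of functions h : X → {0,1} with VC dimension exactly d satisfying: for every α ∈ (0, 1/12) there exist k ≥ c·d·log(1/α) domains D_1, …, D_k (probability distributions on X × {0,1}) such that the set {D_1, …, D_k} is α-shattered by H at threshold 3/10, i.e., Gdim(H, {D_1, …, D_k}, 3/10, α) = k. -/
open MeasureTheory
open scoped ENNReal

/-- A finite set `S ⊆ X` is shattered by a class `H` of total hypotheses:
every function `S → Bool` is the restriction of some `h ∈ H`. -/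
def VCShatters {X : Type*} (H : Set (X → Bool)) (S : Finset X) : Prop :=
  ∀ g : X → Bool, ∃ h ∈ H, ∀ x ∈ S, h x = g x

/-- The VC dimension of a class of total hypotheses. -/
noncomputable def VCdim {X : Type*} (H : Set (X → Bool)) : ℕ∞ :=
  ⨆ (S : Finset X) (_ : VCShatters H S), (S.card : ℕ∞)

/-- The functions on `ι × Y` that are the indicator of a single point on each fibre `{i} × Y`. -/
def selectors (ι Y : Type*) [DecidableEq Y] : Set (ι × Y → Bool) :=
  Set.range fun (f : ι → Y) (p : ι × Y) => decide (p.2 = f p.1)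

theorem vcDim_selectors (ι Y : Type*) [Fintype ι] [DecidableEq Y] [Nontrivial Y] :
    VCdim (selectors ι Y) = (Fintype.card ι : ℕ∞) := by
  classical
  apply le_antisymm
  · refine iSup₂_le fun S hS => ?_
    obtain ⟨_, ⟨f, rfl⟩, hf⟩ := hS fun _ => true
    have hinj : Set.InjOn Prod.fst (S : Set (ι × Y)) := by
      intro p hp q hq hpq
      have h1 := hf p hp
      have h2 := hf q hq
      simp only [decide_eq_true_eq] at h1 h2
      exact Prod.ext hpq (by rw [h1, h2, hpq])
    rw [← Finset.card_image_of_injOn hinj]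
    exact_mod_cast Finset.card_le_univ _
  · obtain ⟨a, b, hab⟩ := exists_pair_ne Y
    have hinj : Function.Injective fun i : ι => (i, a) := fun i j h => (Prod.ext_iff.1 h).1
    have hS : VCShatters (selectors ι Y) (Finset.univ.image fun i : ι => (i, a)) := by
      intro g
      refine ⟨_, ⟨fun i => if g (i, a) then a else b, rfl⟩, ?_⟩
      simp only [Finset.mem_image, Finset.mem_univ, true_and, forall_exists_index]
      rintro _ i rfl
      by_cases h : g (i, a) = true <;> simp [h, hab]
    refine le_trans ?_ (le_iSup₂_of_le _ hS le_rfl)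
    rw [Finset.card_image_of_injective _ hinj, Finset.card_univ]

/-- With probability `1 - T` draw `(z, 0)`, and otherwise `(x, 1)` with `x` uniform in `P`. -/
noncomputable def uniformPositiveDomain {X : Type*} [MeasurableSpace (X × Bool)]
    (P : Finset X) (z : X) (T : ℝ) : Measure (X × Bool) :=
  ENNReal.ofReal (1 - T) • Measure.dirac (z, false) +
    ∑ x ∈ P, ENNReal.ofReal (T / P.card) • Measure.dirac (x, true)

theorem isProbabilityMeasure_uniformPositiveDomain {X : Type*} [MeasurableSpace (X × Bool)]
    {P : Finset X} (hP : P.Nonempty) (z : X) {T : ℝ} (hT0 : 0 ≤ T) (hT1 : T ≤ 1) :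
    IsProbabilityMeasure (uniformPositiveDomain P z T) := by
  have hc : (0 : ℝ) < P.card := by exact_mod_cast hP.card_pos
  constructor
  simp only [uniformPositiveDomain, Measure.add_apply, Measure.smul_apply,
    Measure.finsetSum_apply, measure_univ, smul_eq_mul, mul_one, Finset.sum_const, nsmul_eq_mul]
  rw [← ENNReal.ofReal_natCast, ← ENNReal.ofReal_mul hc.le, ← ENNReal.ofReal_add (by linarith)
    (by positivity), mul_div_cancel₀ _ hc.ne']
  simp

theorem errD_uniformPositiveDomain {X : Type*} [MeasurableSpace (X × Bool)]
    [DiscreteMeasurableSpace (X × Bool)] (P : Finset X) {z : X} {T : ℝ} (hT0 : 0 ≤ T)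
    {h : X → Bool} (hz : h z = false) :
    errD (uniformPositiveDomain P z T) h = T / P.card * (P.filter fun x => h x = false).card := by
  have hm : 0 ≤ T / P.card := by positivity
  have hA : MeasurableSet {p : X × Bool | p.2 ≠ h p.1} := .of_discrete
  have hsum : ∀ x ∈ P, ENNReal.ofReal (T / P.card) *
      Measure.dirac (x, true) {p : X × Bool | p.2 ≠ h p.1} =
        if h x = false then ENNReal.ofReal (T / P.card) else 0 := by
    intro x _
    rw [Measure.dirac_apply' _ hA]
    cases hx : h x <;> simp [Set.indicator, hx]
  simp only [errD, uniformPositiveDomain, Measure.add_apply, Measure.smul_apply,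
    Measure.finsetSum_apply, smul_eq_mul]
  rw [Finset.sum_congr rfl hsum, Measure.dirac_apply' _ hA, ← Finset.sum_filter]
  simp [hz, ENNReal.toReal_ofReal hm, mul_comm]

/-- A family of domains on which `H` realizes every pattern of small and large errors consists of
distinct domains, is `α`-shattered, and has full domain shattering dimension. -/
theorem gdim_range_of_realizes {X ι : Type*} [Fintype ι] [MeasurableSpace (X × Bool)]
    {H : Set (X → Bool)} {τ α : ℝ} (hα : 0 < α) (D : ι → Measure (X × Bool))
    (hD : ∀ s : Set ι, ∃ h ∈ H, (∀ i ∈ s, errD (D i) h < τ - α) ∧ ∀ i ∉ s, τ < errD (D i) h) :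
    Function.Injective D ∧ AlphaShattered H (Set.range D) τ α ∧
      Gdim H (Set.range D) τ α = (Fintype.card ι : ℕ∞) := by
  classical
  have hinj : Function.Injective D := by
    intro i j hij
    by_contra hne
    obtain ⟨h, -, h1, h2⟩ := hD {i}
    have h1 := h1 i rfl
    have h2 := h2 j fun hj => hne hj.symm
    rw [hij] at h1
    linarith
  have hsh : AlphaShattered H (Set.range D) τ α := by
    intro E hE
    obtain ⟨h, hH, h1, h2⟩ := hD (D ⁻¹' E)
    refine ⟨h, hH, fun μ hμ => ?_, ?_⟩
    · obtain ⟨i, rfl⟩ := hE hμ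
      exact h1 i hμ
    · rintro _ ⟨⟨i, rfl⟩, hi⟩
      exact h2 i hi
  have hcoe : ((Finset.univ.image D : Finset _) : Set (Measure (X × Bool))) = Set.range D := by
    simp
  refine ⟨hinj, hsh, le_antisymm (iSup₂_le fun S hS => ?_) ?_⟩
  · have hsub : S ⊆ Finset.univ.image D := by
      rw [← Finset.coe_subset, hcoe]
      exact hS.1
    exact_mod_cast (Finset.card_le_card hsub).trans Finset.card_image_le
  · refine le_trans ?_ (le_iSup₂_of_le (Finset.univ.image D) ⟨hcoe.le, hcoe ▸ hsh⟩ le_rfl)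
    rw [Finset.card_image_of_injective _ hinj, Finset.card_univ]

/-- The points of the fibre over `b` coded by the subsets of `{0, …, n - 1}` containing `j`. -/
def codesContaining {ι : Type*} (n : ℕ) (b : ι) (j : ℕ) : Finset (ι × Finset ℕ) :=
  ((Finset.range n).powerset.filter fun E => j ∈ E).map (Function.Embedding.sectR b _)

theorem mem_codesContaining {ι : Type*} {n : ℕ} {b : ι} {j : ℕ} {p : ι × Finset ℕ} :
    p ∈ codesContaining n b j ↔ p.1 = b ∧ p.2 ⊆ Finset.range n ∧ j ∈ p.2 := by
  obtain ⟨c, E⟩ := p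
  simp only [codesContaining, Finset.mem_map, Finset.mem_filter, Finset.mem_powerset,
    Function.Embedding.sectR_apply, Prod.mk.injEq]
  aesop

theorem card_codesContaining_le {ι : Type*} (n : ℕ) (b : ι) (j : ℕ) :
    (codesContaining n b j).card ≤ 2 ^ n := by
  rw [codesContaining, Finset.card_map]
  exact (Finset.card_filter_le _ _).trans (by simp)

theorem codesContaining_nonempty {ι : Type*} {n : ℕ} (b : ι) {j : ℕ} (hj : j < n) :
    (codesContaining n b j).Nonempty :=
  ⟨(b, Finset.range n), mem_codesContaining.2 ⟨rfl, subset_rfl, Finset.mem_range.2 hj⟩⟩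

theorem selectors_realize_codes {ι : Type*} [MeasurableSpace ((ι × Finset ℕ) × Bool)]
    [DiscreteMeasurableSpace ((ι × Finset ℕ) × Bool)] {n : ℕ} {α : ℝ} (hα : 0 < α)
    (hn : 2 ^ n * α ≤ 1 / 4) (s : Set (ι × Fin n)) :
    ∃ h ∈ selectors ι (Finset ℕ),
      (∀ i ∈ s, errD (uniformPositiveDomain (codesContaining n i.1 i.2) (i.1, {n})
        (3 / 10 + α / 10)) h < 3 / 10 - α) ∧
      ∀ i ∉ s, 3 / 10 < errD (uniformPositiveDomain (codesContaining n i.1 i.2) (i.1, {n})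
        (3 / 10 + α / 10)) h := by
  classical
  let f : ι → Finset ℕ := fun b => (Finset.univ.filter fun j : Fin n => (b, j) ∈ s).image Fin.val
  have hmem : ∀ (b : ι) (j : Fin n), (j : ℕ) ∈ f b ↔ (b, j) ∈ s := by
    intro b j
    simp [f, Fin.val_inj]
  have hsub : ∀ b, f b ⊆ Finset.range n := by
    intro b x hx
    simp only [f, Finset.mem_image] at hx
    obtain ⟨j, -, rfl⟩ := hx
    exact Finset.mem_range.2 j.2
  have hdummy : ∀ b, ({n} : Finset ℕ) ≠ f b := by
    intro b h
    have := hsub b (h ▸ Finset.mem_singleton_self n)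
    simp at this
  refine ⟨_, ⟨f, rfl⟩, ?_, ?_⟩
  · rintro ⟨b, j⟩ hi
    rw [errD_uniformPositiveDomain _ (by positivity) (by simpa using hdummy b)]
    have hfilter : ((codesContaining n b j).filter fun p => decide (p.2 = f p.1) = false) =
        (codesContaining n b j).erase (b, f b) := by
      ext ⟨c, E⟩
      simp only [Finset.mem_filter, Finset.mem_erase, mem_codesContaining, decide_eq_false_iff_not,
        ne_eq, Prod.mk.injEq]
      aesop
    have hin : (b, f b) ∈ codesContaining n b j :=
      mem_codesContaining.2 ⟨rfl, hsub b, (hmem b j).2 hi⟩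
    have hpos : 0 < (codesContaining n b j).card := Finset.card_pos.2 ⟨_, hin⟩
    have hle : ((codesContaining n b j).card : ℝ) ≤ 2 ^ n := by
      exact_mod_cast card_codesContaining_le n b j
    simp only [hfilter]
    rw [Finset.card_erase_of_mem hin, Nat.cast_sub hpos, Nat.cast_one]
    have hpos' : (0 : ℝ) < (codesContaining n b j).card := by exact_mod_cast hpos
    generalize ((codesContaining n b j).card : ℝ) = N at *
    have hN : N * α ≤ 1 / 4 := (mul_le_mul_of_nonneg_right hle hα.le).trans hn
    rw [div_mul_eq_mul_div, div_lt_iff₀ hpos']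
    nlinarith
  · rintro ⟨b, j⟩ hi
    rw [errD_uniformPositiveDomain _ (by positivity) (by simpa using hdummy b)]
    have hfilter : ((codesContaining n b j).filter fun p => decide (p.2 = f p.1) = false) =
        codesContaining n b j := by
      refine Finset.filter_true_of_mem ?_
      rintro ⟨c, E⟩ hp
      obtain ⟨rfl, -, hj⟩ := mem_codesContaining.1 hp
      simp only [decide_eq_false_iff_not]
      rintro rfl
      exact hi ((hmem _ j).1 hj)
    have hpos : (0 : ℝ) < (codesContaining n b j).card := by
      exact_mod_cast (codesContaining_nonempty b j.2).card_pos
    simp only [hfilter]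
    rw [div_mul_cancel₀ _ hpos.ne']
    linarith

theorem exists_pow_two_mul_le_and_log_le {α : ℝ} (hα0 : 0 < α) (hα1 : α < 1 / 12) :
    ∃ n : ℕ, 2 ^ n * α ≤ 1 / 4 ∧ 1 / 4 * Real.log (1 / α) ≤ n := by
  have hx : 3 < 1 / (4 * α) := by
    rw [lt_div_iff₀ (by positivity)]
    linarith
  obtain ⟨n, h1, h2⟩ := exists_nat_pow_near (by linarith : 1 ≤ 1 / (4 * α)) one_lt_two
  rw [le_div_iff₀ (by positivity)] at h1
  have hn : 1 ≤ n := by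
    by_contra! h
    obtain rfl : n = 0 := by omega
    norm_num at h2
    norm_num at hx
    linarith
  refine ⟨n, by linarith, ?_⟩
  have h3 : 1 / α ≤ 2 ^ (n + 3) := by
    have : 1 / α = 4 * (1 / (4 * α)) := by field_simp
    rw [this, pow_add]
    linarith [pow_succ (2 : ℝ) n]
  have h4 := Real.log_le_log (by positivity) h3
  rw [Real.log_pow] at h4
  have h5 := Real.log_two_lt_d9
  have hn' : (1 : ℝ) ≤ n := by exact_mod_cast hn
  push_cast at h4
  nlinarith

/-- Theorem 5.1: there is an absolute constant `c > 0` such that for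
every `d ≥ 1` there are a set `X` and a hypothesis class `H` with VC dimension exactly
`d` such that for every `α ∈ (0, 1/12)` there exist `k ≥ c·d·log(1/α)` domains
`D_1, …, D_k` whose set is `α`-shattered by `H` at threshold `3/10`, i.e.
`Gdim(H, {D_1,…,D_k}, 3/10, α) = k`. -/
theorem gdim_can_exceed_vcdim :
    ∃ c : ℝ, 0 < c ∧
    ∀ d : ℕ, 0 < d →
      ∃ (X : Type) (mXB : MeasurableSpace (X × Bool)) (H : Set (X → Bool)),
        VCdim H = (d : ℕ∞) ∧
        ∀ α : ℝ, α ∈ Set.Ioo (0:ℝ) (1/12) →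
          ∃ (k : ℕ) (Ds : Fin k → @Measure (X × Bool) mXB),
            c * d * Real.log (1 / α) ≤ (k : ℝ) ∧
            (∀ i, @IsProbabilityMeasure _ mXB (Ds i)) ∧
            Function.Injective Ds ∧
            @AlphaShattered X mXB H (Set.range Ds) (3/10) α ∧
            @Gdim X mXB H (Set.range Ds) (3/10) α = (k : ℕ∞) := by
  refine ⟨1 / 4, by norm_num, fun d _ => ⟨Fin d × Finset ℕ, ⊤, selectors (Fin d) (Finset ℕ), ?_, ?_⟩⟩
  · simpa using vcDim_selectors (Fin d) (Finset ℕ)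
  rintro α ⟨hα0, hα1⟩
  let _ : MeasurableSpace ((Fin d × Finset ℕ) × Bool) := ⊤
  have : DiscreteMeasurableSpace ((Fin d × Finset ℕ) × Bool) := ⟨fun _ => trivial⟩
  obtain ⟨n, hn, hlog⟩ := exists_pow_two_mul_le_and_log_le hα0 hα1
  let D : Fin d × Fin n → Measure ((Fin d × Finset ℕ) × Bool) := fun i =>
    uniformPositiveDomain (codesContaining n i.1 i.2) (i.1, {n}) (3 / 10 + α / 10)
  obtain ⟨hinj, hsh, hdim⟩ := gdim_range_of_realizes hα0 D (selectors_realize_codes hα0 hn)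
  have hrange : Set.range (D ∘ finProdFinEquiv.symm) = Set.range D :=
    finProdFinEquiv.symm.surjective.range_comp D
  refine ⟨d * n, D ∘ finProdFinEquiv.symm, ?_, fun i => ?_,
    hinj.comp finProdFinEquiv.symm.injective, ?_, ?_⟩
  · push_cast
    nlinarith [mul_le_mul_of_nonneg_left hlog (Nat.cast_nonneg (α := ℝ) d)]
  · exact isProbabilityMeasure_uniformPositiveDomain
      (codesContaining_nonempty _ (Fin.is_lt _)) _ (by positivity) (by linarith)
  · rw [hrange]
    exact hsh
  · rw [hrange, hdim]
    simp
end

section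
/- Let m be an odd positive integer, let X = {0, 1, …, m}, and for each i ∈ {1, …, m} define h_i : X → {0,1} by h_i(x) = 1 if x ≥ i and h_i(x) = 0 otherwise. Then there exists a probability distribution D on X × {0,1} such that err_D(h_i) = 3/10 − 1/(4m) for every odd i ∈ {1, …, m} and err_D(h_i) = 3/10 + 1/(4m) for every even i ∈ {1, …, m}. -/
open MeasureTheory
open scoped ENNReal

/-- The number of labels `Odd x`, `1 ≤ x ≤ n`, on which the threshold at `i` errs. -/
lemma card_threshold_disagree_odd (i n : ℕ) (hi : 1 ≤ i) :
    (∑ j ∈ Finset.range n, if decide (Odd (j + 1)) ≠ decide (i ≤ j + 1) then 1 else 0) =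
      if n < i then (n + 1) / 2 else i / 2 + n / 2 - (i - 1) / 2 := by
  induction n with
  | zero => simp; omega
  | succ n ih =>
    rw [Finset.sum_range_succ, ih]
    simp only [ne_eq, decide_eq_decide, Nat.odd_iff]
    split_ifs <;> omega

/-- Mass `1/20` on `(0, 1)`, mass `9/20` on `(m, 1)`, and mass `1/(2m)` on each
`(x, 1[x odd])` with `1 ≤ x ≤ m`. -/
noncomputable def oddEvenDomain (m : ℕ) : Measure (Fin (m + 1) × Bool) :=
  ENNReal.ofReal (1 / 20) • Measure.dirac (0, true) +
    ENNReal.ofReal (9 / 20) • Measure.dirac (Fin.last m, true) +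
    ENNReal.ofReal (1 / (2 * m)) •
      ∑ j : Fin m, Measure.dirac (j.succ, decide (Odd ((j : ℕ) + 1)))

open scoped Classical in
lemma oddEvenDomain_apply (m : ℕ) (s : Set (Fin (m + 1) × Bool)) :
    oddEvenDomain m s = ENNReal.ofReal
      (1 / 20 * (if (0, true) ∈ s then 1 else 0) +
        9 / 20 * (if (Fin.last m, true) ∈ s then 1 else 0) +
        1 / (2 * m) *
          ((∑ j : Fin m, if (j.succ, decide (Odd ((j : ℕ) + 1))) ∈ s then 1 else 0 : ℕ) : ℝ)) := by
  rw [ENNReal.ofReal_add (by positivity) (by positivity),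
    ENNReal.ofReal_add (by positivity) (by positivity),
    ENNReal.ofReal_mul (by positivity), ENNReal.ofReal_mul (by positivity),
    ENNReal.ofReal_mul (by positivity), ENNReal.ofReal_natCast]
  simp only [oddEvenDomain, Measure.add_apply, Measure.smul_apply, Measure.finsetSum_apply,
    Measure.dirac_apply' _ s.toFinite.measurableSet, Set.indicator_apply, Pi.one_apply,
    smul_eq_mul, apply_ite ENNReal.ofReal, ENNReal.ofReal_one, ENNReal.ofReal_zero]
  push_cast
  rfl

lemma errD_oddEvenDomain (m : ℕ) (h : Fin (m + 1) → Bool) :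
    errD (oddEvenDomain m) h =
      1 / 20 * (if true ≠ h 0 then 1 else 0) + 9 / 20 * (if true ≠ h (Fin.last m) then 1 else 0) +
        1 / (2 * m) *
          ((∑ j : Fin m, if decide (Odd ((j : ℕ) + 1)) ≠ h j.succ then 1 else 0 : ℕ) : ℝ) := by
  rw [errD, oddEvenDomain_apply, ENNReal.toReal_ofReal (by positivity)]
  simp only [Set.mem_ofPred_eq]
  congr!

/-- Lemma 5.3: for odd `m ≥ 1`, on `X = {0, 1, …, m}` with threshold
hypotheses `h_i(x) = 1[x ≥ i]` for `i ∈ {1,…,m}`, there is a distribution `D` on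
`X × {0,1}` with `err_D(h_i) = 3/10 - 1/(4m)` for odd `i` and
`err_D(h_i) = 3/10 + 1/(4m)` for even `i`. -/
theorem odd_even_threshold_errors (m : ℕ) (hodd : Odd m) (hpos : 0 < m) :
    ∃ D : Measure (Fin (m + 1) × Bool), IsProbabilityMeasure D ∧
      ∀ i : ℕ, 1 ≤ i → i ≤ m →
        errD D (fun x : Fin (m + 1) => decide (i ≤ (x : ℕ))) =
          if Odd i then 3 / 10 - 1 / (4 * (m : ℝ)) else 3 / 10 + 1 / (4 * (m : ℝ)) := by
  have hm : (m : ℝ) ≠ 0 := by positivity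
  refine ⟨oddEvenDomain m, ⟨?_⟩, fun i hi him => ?_⟩
  · rw [oddEvenDomain_apply, ← ENNReal.ofReal_one]
    congr 1
    simp
    field_simp
    norm_num
  · have h_count := card_threshold_disagree_odd i m hi
    rw [← Fin.sum_univ_eq_sum_range
      (fun j => if decide (Odd (j + 1)) ≠ decide (i ≤ j + 1) then 1 else 0)] at h_count
    have h_zero : true ≠ decide (i ≤ ((0 : Fin (m + 1)) : ℕ)) := by simp; omega
    have h_last : ¬ true ≠ decide (i ≤ (Fin.last m : ℕ)) := by simp [him]
    rw [errD_oddEvenDomain, if_pos h_zero, if_neg h_last]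
    simp only [Fin.val_succ]
    rw [h_count]
    obtain ⟨k, rfl⟩ := hodd
    have h_value : (if 2 * k + 1 < i then (2 * k + 1 + 1) / 2
        else i / 2 + (2 * k + 1) / 2 - (i - 1) / 2) = if Odd i then k else k + 1 := by
      simp only [Nat.odd_iff]
      split_ifs <;> omega
    rw [h_value]
    split_ifs <;> push_cast at hm ⊢ <;> field_simp <;> ring
end

section
/- There exists an absolute constant C > 0 such that the following holds. Let H be a class of hypotheses h : X → {0,1} with finite VC dimension d ≥ 1. Then for every family G of domains (probability distributions on X × {0,1}), every threshold τ ∈ ℝ, and every margin α ∈ (0, 1/2), the domain shattering dimension satisfies Gdim(H, G, τ, α) ≤ C·d·log(1/α). -/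
open MeasureTheory
open scoped ENNReal

section SampleFrequency

open ProbabilityTheory

variable {Ω : Type*} [MeasurableSpace Ω]

/-- The fraction of the points of the sample `ω` that lie in `A`. -/
noncomputable def sampleFreq {n : ℕ} (A : Set Ω) (ω : Fin n → Ω) : ℝ :=
  (∑ j, A.indicator 1 (ω j)) / n

/-- The samples on which the frequency of `A` is within `ε` of its probability. -/
def accurateSamples (μ : Measure Ω) (n : ℕ) (A : Set Ω) (ε : ℝ) : Set (Fin n → Ω) :=
  {ω | |sampleFreq A ω - μ.real A| < ε}

lemma mem_accurateSamples {μ : Measure Ω} {n : ℕ} {A : Set Ω} {ε : ℝ} {ω : Fin n → Ω} :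
    ω ∈ accurateSamples μ n A ε ↔ |sampleFreq A ω - μ.real A| < ε :=
  Iff.rfl

lemma measurable_sampleFreq {n : ℕ} {A : Set Ω} (hA : MeasurableSet A) :
    Measurable (sampleFreq (n := n) A) := by
  refine (Finset.measurable_sum _ fun j _ => ?_).div_const _
  exact (measurable_one.indicator hA).comp (measurable_pi_apply j)

lemma measurableSet_accurateSamples (μ : Measure Ω) (n : ℕ) {A : Set Ω}
    (hA : MeasurableSet A) (ε : ℝ) : MeasurableSet (accurateSamples μ n A ε) :=
  measurableSet_lt (((measurable_sampleFreq hA).sub_const _).norm) measurable_const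

lemma three_quarters_le_measureReal_accurateSamples (μ : Measure Ω) [IsProbabilityMeasure μ]
    {n : ℕ} {A : Set Ω} (hA : MeasurableSet A) {ε : ℝ} (hε : 0 < ε) (hn : 1 ≤ n * ε ^ 2) :
    3 / 4 ≤ (Measure.pi fun _ : Fin n => μ).real (accurateSamples μ n A ε) := by
  have hn0 : 0 < (n : ℝ) := by
    by_contra h
    have : (n : ℝ) = 0 := le_antisymm (not_lt.mp h) (Nat.cast_nonneg n)
    simp [this] at hn
    linarith
  set P := Measure.pi fun _ : Fin n => μ
  set f : Ω → ℝ := A.indicator 1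
  set Y : (Fin n → Ω) → ℝ := ∑ j, fun ω => f (ω j) with hY
  have hf : Measurable f := measurable_one.indicator hA
  have hf01 : ∀ x, f x ∈ Set.Icc (0 : ℝ) 1 := fun x => by
    by_cases hx : x ∈ A <;> simp [f, hx]
  have hfL : ∀ p, MemLp f p μ := fun p =>
    MemLp.of_bound hf.aestronglyMeasurable 1 <| .of_forall fun x => by
      rw [Real.norm_eq_abs, abs_of_nonneg (hf01 x).1]; exact (hf01 x).2
  have hfj : ∀ p (j : Fin n), MemLp (fun ω : Fin n → Ω => f (ω j)) p P := fun p j =>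
    (hfL p).comp_measurePreserving (measurePreserving_eval (fun _ : Fin n => μ) j)
  have hYL : MemLp Y 2 P := memLp_finsetSum' _ fun j _ => hfj 2 j
  have hYint : ∫ ω, Y ω ∂P = n * μ.real A := by
    simp only [hY, Finset.sum_apply]
    rw [integral_finsetSum _ fun j _ => (hfj 1 j).integrable le_rfl]
    simp_rw [P, integral_comp_eval (μ := fun _ : Fin n => μ) hf.aestronglyMeasurable, f,
      integral_indicator_one hA]
    simp
  have hVar : Var[Y; P] ≤ n / 4 := by
    rw [hY, variance_sum_pi fun _ => hfL 2]
    calc ∑ _ : Fin n, Var[f; μ] ≤ ∑ _ : Fin n, ((1 - 0) / 2 : ℝ) ^ 2 :=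
          Finset.sum_le_sum fun _ _ =>
            variance_le_sq_of_bounded (.of_forall hf01) hf.aemeasurable
      _ = n / 4 := by simp; ring
  have hsub : (accurateSamples μ n A ε)ᶜ = {ω | n * ε ≤ |Y ω - ∫ ω, Y ω ∂P|} := by
    ext ω
    have : sampleFreq A ω - μ.real A = (Y ω - ∫ ω, Y ω ∂P) / n := by
      rw [hYint, sampleFreq, hY, Finset.sum_apply]
      field_simp
      rfl
    simp only [mem_accurateSamples, Set.mem_compl_iff, Set.mem_ofPred_eq, not_lt]
    rw [this, abs_div, abs_of_pos hn0, le_div_iff₀ hn0, mul_comm]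
  have hcheb := meas_ge_le_variance_div_sq hYL (mul_pos hn0 hε)
  rw [← hsub] at hcheb
  have hcompl : P.real (accurateSamples μ n A ε)ᶜ ≤ 1 / 4 := by
    refine ENNReal.toReal_le_of_le_ofReal (by norm_num) (hcheb.trans ?_)
    apply ENNReal.ofReal_le_ofReal
    rw [div_le_iff₀ (by positivity)]
    nlinarith
  rw [probReal_compl_eq_one_sub (measurableSet_accurateSamples μ n hA ε)] at hcompl
  linarith

open Classical in
lemma exists_card_mul_le_card_filter_mem (μ : Measure Ω) [IsProbabilityMeasure μ]
    {κ : Type*} [Fintype κ] {B : κ → Set Ω} (hB : ∀ e, MeasurableSet (B e)) {c : ℝ}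
    (hc : ∀ e, c ≤ μ.real (B e)) :
    ∃ ω, Fintype.card κ * c ≤ (Finset.univ.filter fun e => ω ∈ B e).card := by
  have hint : ∀ e, Integrable ((B e).indicator (1 : Ω → ℝ)) μ := fun e =>
    (integrable_const (1 : ℝ)).indicator (hB e)
  obtain ⟨ω, hω⟩ := exists_integral_le
    (integrable_finsetSum Finset.univ fun e _ => hint e)
  refine ⟨ω, ?_⟩
  rw [integral_finsetSum _ fun e _ => hint e] at hω
  calc (Fintype.card κ : ℝ) * c = ∑ _ : κ, c := by simp
    _ ≤ ∑ e, ∫ x, (B e).indicator (1 : Ω → ℝ) x ∂μ :=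
        Finset.sum_le_sum fun e _ => by rw [integral_indicator_one (hB e)]; exact hc e
    _ ≤ ∑ e, (B e).indicator (1 : Ω → ℝ) ω := hω
    _ = _ := by simp [Set.indicator_apply]

open Classical in
/-- Independent samples from finitely many distributions are simultaneously accurate for a
`(3 / 4) ^ card ι` fraction of any finite collection of events. -/
lemma exists_samples_card_accurate {ι κ : Type*} [Fintype ι] [Fintype κ] (D : ι → Measure Ω)
    [∀ i, IsProbabilityMeasure (D i)] {n : ℕ} {A : κ → Set Ω} (hA : ∀ e, MeasurableSet (A e))
    {ε : ℝ} (hε : 0 < ε) (hn : 1 ≤ n * ε ^ 2) :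
    ∃ ω : ι → Fin n → Ω, Fintype.card κ * (3 / 4 : ℝ) ^ Fintype.card ι ≤
      (Finset.univ.filter fun e => ∀ i, ω i ∈ accurateSamples (D i) n (A e) ε).card := by
  have h := exists_card_mul_le_card_filter_mem
    (Measure.pi fun i => Measure.pi fun _ : Fin n => D i)
    (B := fun e => Set.univ.pi fun i => accurateSamples (D i) n (A e) ε)
    (c := (3 / 4 : ℝ) ^ Fintype.card ι)
    (fun e => .univ_pi fun i => measurableSet_accurateSamples _ _ (hA e) _) fun e => by
      rw [Measure.real, Measure.pi_pi, ENNReal.toReal_prod, ← Finset.card_univ]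
      rw [← Finset.prod_const]
      exact Finset.prod_le_prod (fun _ _ => by norm_num) fun i _ =>
        three_quarters_le_measureReal_accurateSamples (D i) (hA e) hε hn
  simpa only [Set.mem_univ_pi] using h

end SampleFrequency

lemma sum_choose_le {m d : ℕ} {x : ℝ} (hx : 0 < x) (hx1 : x ≤ 1) :
    ((∑ i ∈ Finset.Iic d, m.choose i : ℕ) : ℝ) ≤ x⁻¹ ^ d * Real.exp (m * x) := by
  have hterm : ∀ i ∈ Finset.Iic d, (m.choose i : ℝ) ≤ x⁻¹ ^ d * (x ^ i * m.choose i) := by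
    intro i hi
    rw [← mul_assoc, inv_pow]
    refine le_mul_of_one_le_left (by positivity) ?_
    rw [inv_mul_eq_div, one_le_div (by positivity)]
    exact pow_le_pow_of_le_one hx.le hx1 (Finset.mem_Iic.mp hi)
  have hsum : ∑ i ∈ Finset.Iic d, x ^ i * (m.choose i : ℝ) ≤ (x + 1) ^ m := by
    rw [add_pow]
    simp only [one_pow, mul_one]
    by_cases hdm : d ≤ m
    · refine Finset.sum_le_sum_of_subset_of_nonneg (fun i hi => ?_) fun i _ _ => by positivity
      simp only [Finset.mem_Iic, Finset.mem_range] at *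
      omega
    · refine (Finset.sum_subset (fun i hi => ?_) fun i _ hi => ?_).ge
      · simp only [Finset.mem_Iic, Finset.mem_range] at *
        omega
      · rw [Nat.choose_eq_zero_of_lt (by simpa using hi)]
        simp
  push_cast
  calc ∑ i ∈ Finset.Iic d, (m.choose i : ℝ)
      ≤ ∑ i ∈ Finset.Iic d, x⁻¹ ^ d * (x ^ i * m.choose i) := Finset.sum_le_sum hterm
    _ = x⁻¹ ^ d * ∑ i ∈ Finset.Iic d, x ^ i * m.choose i := by rw [Finset.mul_sum]
    _ ≤ x⁻¹ ^ d * (x + 1) ^ m := by gcongr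
    _ ≤ x⁻¹ ^ d * Real.exp (m * x) := by
        gcongr
        rw [Real.exp_nat_mul]
        gcongr
        exact Real.add_one_le_exp x

lemma VCShatters.card_le {X : Type*} {H : Set (X → Bool)} {d : ℕ} (hd : VCdim H ≤ d)
    {T : Finset X} (hT : VCShatters H T) : T.card ≤ d := by
  have h : (T.card : ℕ∞) ≤ VCdim H := le_iSup₂ (f := fun (S : Finset X)
    (_ : VCShatters H S) => (S.card : ℕ∞)) T hT
  exact_mod_cast h.trans hd

open Classical in
/-- The Sauer–Shelah bound on the number of patterns a class induces on an indexed family of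
points, repetitions allowed. -/
lemma card_patterns_le {X ι : Type*} [Fintype ι] {H : Set (X → Bool)} {d : ℕ}
    (hd : VCdim H ≤ d) (x : ι → X) {𝒜 : Finset (Finset ι)}
    (h𝒜 : ∀ s ∈ 𝒜, ∃ h ∈ H, s = Finset.univ.filter fun i => h (x i) = true) :
    𝒜.card ≤ ∑ i ∈ Finset.Iic d, (Fintype.card ι).choose i := by
  have hdim : 𝒜.vcDim ≤ d := by
    refine Finset.sup_le fun s hs => ?_
    rw [Finset.mem_shatterer] at hs
    have hpat : ∀ t ⊆ s, ∃ h ∈ H, ∀ i ∈ s, h (x i) = true ↔ i ∈ t := by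
      intro t ht
      obtain ⟨u, hu, rfl⟩ := hs ht
      obtain ⟨h, hh, rfl⟩ := h𝒜 u hu
      exact ⟨h, hh, fun i hi => by simp [hi]⟩
    have hinj : Set.InjOn x s := by
      intro i hi j hj hij
      obtain ⟨h, -, hh⟩ := hpat {i} (by simpa using hi)
      have hi' := hh i hi
      have hj' := hh j hj
      rw [hij] at hi'
      simpa [eq_comm] using hj'.symm.trans hi'
    rw [← Finset.card_image_of_injOn hinj]
    refine VCShatters.card_le hd fun g => ?_
    obtain ⟨h, hh, hhs⟩ := hpat (s.filter fun i => g (x i) = true) (Finset.filter_subset _ _)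
    refine ⟨h, hh, fun y hy => ?_⟩
    obtain ⟨i, hi, rfl⟩ := Finset.mem_image.mp hy
    rw [Bool.eq_iff_iff]
    simpa [hi] using hhs i hi
  calc 𝒜.card ≤ 𝒜.shatterer.card := 𝒜.card_le_card_shatterer
    _ ≤ ∑ i ∈ Finset.Iic 𝒜.vcDim, (Fintype.card ι).choose i :=
        Finset.card_shatterer_le_sum_vcDim
    _ ≤ _ := Finset.sum_le_sum_of_subset (Finset.Iic_subset_Iic.mpr hdim)

open Classical in
lemma AlphaShattered.three_halves_pow_card_le {X : Type*} [MeasurableSpace (X × Bool)]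
    {H : Set (X → Bool)} {d : ℕ} (hd : VCdim H ≤ d)
    (hH : ∀ h ∈ H, MeasurableSet {p : X × Bool | p.2 ≠ h p.1})
    {S : Finset (Measure (X × Bool))} (hS : ∀ D ∈ S, IsProbabilityMeasure D) {τ α : ℝ}
    (hα : 0 < α) (hSα : AlphaShattered H (S : Set (Measure (X × Bool))) τ α) {n : ℕ}
    (hn : 4 ≤ n * α ^ 2) :
    (3 / 2 : ℝ) ^ S.card ≤ ((∑ i ∈ Finset.Iic d, (S.card * n).choose i : ℕ) : ℝ) := by
  have : ∀ D : S, IsProbabilityMeasure (D : Measure (X × Bool)) := fun D => hS D D.2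
  have hex : ∀ E : Finset S, ∃ h ∈ H, (∀ D : S, D ∈ E → errD D h < τ - α) ∧
      ∀ D : S, D ∉ E → τ < errD D h := by
    intro E
    obtain ⟨h, hh, h1, h2⟩ := hSα (Subtype.val '' (E : Set S)) (by rintro _ ⟨D, -, rfl⟩; exact D.2)
    exact ⟨h, hh, fun D hD => h1 D ⟨D, hD, rfl⟩, fun D hD => h2 D ⟨D.2, by
      rintro ⟨D', hD', he⟩; exact hD (Subtype.ext he ▸ hD')⟩⟩
  choose h hhH hlow hhigh using hex
  set A : Finset S → Set (X × Bool) := fun E => {p | p.2 ≠ h E p.1} with hA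
  obtain ⟨ω, hω⟩ := exists_samples_card_accurate (fun D : S => (D : Measure (X × Bool)))
    (fun E => hH (h E) (hhH E)) (half_pos hα) (n := n) (by linarith)
  set good := Finset.univ.filter fun E =>
    ∀ D : S, ω D ∈ accurateSamples (D : Measure (X × Bool)) n (A E) (α / 2) with hgood
  set x : S × Fin n → X := fun q => (ω q.1 q.2).1
  set pat : Finset S → Finset (S × Fin n) := fun E =>
    Finset.univ.filter fun q => h E (x q) = true with hpat
  have hdecode : ∀ E ∈ good, ∀ D : S, D ∈ E ↔ sampleFreq (A E) (ω D) < τ - α / 2 := by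
    intro E hE D
    have hacc := abs_lt.mp (mem_accurateSamples.mp ((Finset.mem_filter.mp hE).2 D))
    have herr : (D : Measure (X × Bool)).real (A E) = errD D (h E) := rfl
    rw [herr] at hacc
    by_cases hD : D ∈ E
    · have := hlow E D hD
      simp only [hD, true_iff]
      linarith
    · have := hhigh E D hD
      simp only [hD, false_iff]
      linarith
  have hinj : Set.InjOn pat good := by
    intro E hE F hF hEF
    have hval : ∀ q, h E (x q) = h F (x q) := fun q => by
      have := Finset.ext_iff.mp hEF q
      simpa [hpat, ← Bool.eq_iff_iff] using this
    have hfreq : ∀ D, sampleFreq (A E) (ω D) = sampleFreq (A F) (ω D) := fun D => by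
      unfold sampleFreq
      congr 1
      refine Finset.sum_congr rfl fun j _ => ?_
      have hj : h E (ω D j).1 = h F (ω D j).1 := hval (D, j)
      simp [Set.indicator_apply, hA, hj]
    ext D
    rw [hdecode E hE D, hdecode F hF D, hfreq]
  have hcard : good.card ≤ ∑ i ∈ Finset.Iic d, (S.card * n).choose i := by
    have h1 := card_patterns_le hd x (𝒜 := good.image pat) fun s hs => by
      obtain ⟨E, -, rfl⟩ := Finset.mem_image.mp hs
      exact ⟨h E, hhH E, rfl⟩
    rw [Finset.card_image_of_injOn hinj] at h1
    simpa using h1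
  calc (3 / 2 : ℝ) ^ S.card = 2 ^ S.card * (3 / 4) ^ S.card := by rw [← mul_pow]; norm_num
    _ ≤ good.card := by simpa using hω
    _ ≤ _ := by exact_mod_cast hcard

lemma AlphaShattered.card_le {X : Type*} [MeasurableSpace (X × Bool)]
    {H : Set (X → Bool)} {d : ℕ} (hd : VCdim H ≤ d)
    (hH : ∀ h ∈ H, MeasurableSet {p : X × Bool | p.2 ≠ h p.1})
    {S : Finset (Measure (X × Bool))} (hS : ∀ D ∈ S, IsProbabilityMeasure D) {τ α : ℝ}
    (hα : 0 < α) (hα2 : α < 1 / 2)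
    (hSα : AlphaShattered H (S : Set (Measure (X × Bool))) τ α) :
    (S.card : ℝ) ≤ 53 * d * Real.log (1 / α) := by
  set n := ⌈4 / α ^ 2⌉₊
  have hn : 4 / α ^ 2 ≤ n := Nat.le_ceil _
  have hn' : (n : ℝ) < 4 / α ^ 2 + 1 := Nat.ceil_lt_add_one (by positivity)
  have hn4 : 4 ≤ n * α ^ 2 := (div_le_iff₀ (by positivity)).mp hn
  have hn1 : (1 : ℝ) ≤ n := by nlinarith
  set L := Real.log (1 / α)
  have hL : 5 * (n : ℝ) ≤ Real.exp (7 * L) := by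
    have hexp : Real.exp (7 * L) = (1 / α) ^ 7 := by
      rw [show (7 : ℝ) = (7 : ℕ) by norm_num, Real.exp_nat_mul, Real.exp_log (by positivity)]
    have hβ : 2 ≤ 1 / α := by rw [le_div_iff₀ hα]; linarith
    rw [hexp]
    have h4 : 4 / α ^ 2 = 4 * (1 / α) ^ 2 := by field_simp
    rw [h4] at hn'
    generalize 1 / α = β at *
    have h5 : (2 : ℝ) ^ 5 ≤ β ^ 5 := by gcongr
    have h2 : (2 : ℝ) ^ 2 ≤ β ^ 2 := by gcongr
    nlinarith [mul_le_mul_of_nonneg_right h5 (sq_nonneg β)]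
  have hmain := (hSα.three_halves_pow_card_le hd hH hS hα hn4).trans
    (sum_choose_le (x := 1 / (5 * n)) (by positivity) (by
      rw [div_le_one (by positivity)]; linarith))
  have h32 : Real.exp (S.card * (1 / 3)) ≤ (3 / 2 : ℝ) ^ S.card := by
    rw [Real.exp_nat_mul]
    gcongr
    rw [← Real.le_log_iff_exp_le (by norm_num)]
    have := Real.one_sub_inv_le_log_of_pos (x := 3 / 2) (by norm_num)
    norm_num at this ⊢
    linarith
  have hle : Real.exp (S.card * (1 / 3)) ≤ Real.exp (d * (7 * L) + S.card * (1 / 5)) := by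
    refine h32.trans (hmain.trans ?_)
    rw [Real.exp_add, Real.exp_nat_mul (7 * L)]
    refine mul_le_mul (pow_le_pow_left₀ (by positivity) (by simpa using hL) d)
      (Real.exp_le_exp.mpr (le_of_eq ?_)) (by positivity) (by positivity)
    push_cast
    field_simp
  have hLd : 0 ≤ (d : ℝ) * L := by
    have : 0 ≤ L := Real.log_nonneg (by rw [le_div_iff₀ hα]; linarith)
    positivity
  linarith [Real.exp_le_exp.mp hle]

/-- Theorem 5.2: there is an absolute constant `C > 0` such that for
every hypothesis class `H` of VC dimension `d ≥ 1`, every family `G` of domains, every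
threshold `τ` and margin `α ∈ (0, 1/2)`, the domain shattering dimension satisfies
`Gdim(H, G, τ, α) ≤ C·d·log(1/α)` (stated as: any `k ≤ Gdim` satisfies
`k ≤ C·d·log(1/α)`). -/
theorem gdim_le_vcdim_log :
    ∃ C : ℝ, 0 < C ∧
    ∀ (X : Type) [MeasurableSpace (X × Bool)] (H : Set (X → Bool)) (d : ℕ),
      1 ≤ d → VCdim H = (d : ℕ∞) →
      (∀ h ∈ H, MeasurableSet {p : X × Bool | p.2 ≠ h p.1}) →
      ∀ G : Set (Measure (X × Bool)), (∀ D ∈ G, IsProbabilityMeasure D) →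
      ∀ τ α : ℝ, 0 < α → α < 1 / 2 →
      ∀ k : ℕ, (k : ℕ∞) ≤ Gdim H G τ α → (k : ℝ) ≤ C * d * Real.log (1 / α) := by
  refine ⟨53, by norm_num, fun X _ H d _ hd hH G hG τ α hα hα2 k hk => ?_⟩
  have hfloor : Gdim H G τ α ≤ (⌊53 * d * Real.log (1 / α)⌋₊ : ℕ) := by
    refine iSup₂_le fun S hS => ?_
    exact_mod_cast Nat.le_floor
      (hS.2.card_le hd.le hH (fun D hD => hG D (hS.1 hD)) hα hα2)
  have hlog : 0 ≤ Real.log (1 / α) := Real.log_nonneg (by rw [le_div_iff₀ hα]; linarith)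
  exact (Nat.le_floor_iff (by positivity)).mp (by exact_mod_cast hk.trans hfloor)
end

section
/- Let H be a class of hypotheses h : X → {0,1}, let G be a family of domains, and let τ, α ∈ (0,1). If G' is a finite (α/2)-cover of G with respect to the (H,τ)-divergence d_{H,τ}, then Gdim(H, G, τ, α) ≤ |G'|. -/
open MeasureTheory
open scoped ENNReal

/-- The `(H, τ)`-divergence
`d_{H,τ}(D, D') := sup { |err_D(h) - err_{D'}(h)| : h ∈ H, min(err_D(h), err_{D'}(h)) ≤ τ }`. -/
noncomputable def dHtau {X : Type*} [MeasurableSpace (X × Bool)]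
    (H : Set (X → Bool)) (τ : ℝ) (D D' : Measure (X × Bool)) : ℝ :=
  sSup {r : ℝ | ∃ h ∈ H, min (errD D h) (errD D' h) ≤ τ ∧ r = |errD D h - errD D' h|}

theorem errD_mem_Icc {X : Type*} [MeasurableSpace (X × Bool)]
    (D : Measure (X × Bool)) [IsProbabilityMeasure D] (h : X → Bool) :
    errD D h ∈ Set.Icc (0 : ℝ) 1 :=
  ⟨ENNReal.toReal_nonneg, ENNReal.toReal_le_of_le_ofReal zero_le_one (by simpa using prob_le_one)⟩

theorem abs_errD_sub_le_dHtau {X : Type*} [MeasurableSpace (X × Bool)]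
    {H : Set (X → Bool)} {τ : ℝ} {D D' : Measure (X × Bool)}
    [IsProbabilityMeasure D] [IsProbabilityMeasure D'] {h : X → Bool} (hh : h ∈ H)
    (hmin : min (errD D h) (errD D' h) ≤ τ) :
    |errD D h - errD D' h| ≤ dHtau H τ D D' := by
  refine le_csSup ⟨1, ?_⟩ ⟨h, hh, hmin, rfl⟩
  rintro _ ⟨g, -, -, rfl⟩
  obtain ⟨h0, h1⟩ := errD_mem_Icc D g
  obtain ⟨h0', h1'⟩ := errD_mem_Icc D' g
  rw [abs_le]
  constructor <;> linarith

/-- Theorem 6.1: if `G'` is a finite `(α/2)`-cover of `G` with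
respect to the `(H,τ)`-divergence, then `Gdim(H, G, τ, α) ≤ |G'|`. -/
theorem gdim_le_cover_size {X : Type*} [MeasurableSpace (X × Bool)]
    (H : Set (X → Bool)) (G : Set (Measure (X × Bool))) (τ α : ℝ)
    (hτ : τ ∈ Set.Ioo (0:ℝ) 1) (hα : α ∈ Set.Ioo (0:ℝ) 1)
    (hGprob : ∀ D ∈ G, IsProbabilityMeasure D)
    (G' : Finset (Measure (X × Bool)))
    (hG'prob : ∀ D ∈ G', IsProbabilityMeasure D)
    (hcover : ∀ D ∈ G, ∃ D' ∈ G', dHtau H τ D D' ≤ α / 2) :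
    Gdim H G τ α ≤ (G'.card : ℕ∞) := by
  obtain ⟨hα0, -⟩ := hα
  refine iSup₂_le fun S ⟨hSG, hS⟩ => ?_
  choose! f hf hfd using hcover
  refine Nat.cast_le.mpr (Finset.card_le_card_of_injOn f (fun D hD => hf D (hSG hD)) ?_)
  intro D₁ h₁ D₂ h₂ hEq
  by_contra hne
  obtain ⟨h, hh, hlow, hhigh⟩ := hS {D₁} (Set.singleton_subset_iff.mpr h₁)
  have hlow₁ := hlow D₁ rfl
  have hhigh₂ := hhigh D₂ ⟨h₂, fun hmem => hne (Set.mem_singleton_iff.mp hmem).symm⟩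
  have := hGprob D₁ (hSG h₁)
  have := hGprob D₂ (hSG h₂)
  have := hG'prob (f D₁) (hf D₁ (hSG h₁))
  have hd₁ := (abs_errD_sub_le_dHtau (D := D₁) (D' := f D₁) hh
    (min_le_of_left_le (by linarith))).trans (hfd D₁ (hSG h₁))
  rw [abs_le] at hd₁
  have hd₂ := (abs_errD_sub_le_dHtau (D := D₂) (D' := f D₁) hh
    (min_le_of_right_le (by linarith))).trans (hEq ▸ hfd D₂ (hSG h₂))
  rw [abs_le] at hd₂
  linarith
end

section
/- There exists an absolute constant c > 0 such that the following holds. Let X = ℕ and let H = {h_i : i ≥ 1} where h_i(x) = 1 if x ≥ i and h_i(x) = 0 otherwise. Then the VC dimension of H is 1, and for every α ∈ (0, 1/12) there exist k ≥ c·log(1/α) probability distributions D_1, …, D_k on ℕ × {0,1} such that {D_1, …, D_k} is α-shattered by H at threshold 3/10, i.e., Gdim(H, {D_1, …, D_k}, 3/10, α) = k. -/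
open MeasureTheory
open scoped ENNReal

/-- The class of threshold hypotheses `h_i(x) = 1[x ≥ i]`, `i ≥ 1`, on `ℕ`. -/
def thresholdClass : Set (ℕ → Bool) :=
  {h | ∃ i : ℕ, 1 ≤ i ∧ h = fun x => decide (i ≤ x)}

open scoped NNReal

theorem vcdim_thresholdClass : VCdim thresholdClass = (1 : ℕ∞) := by
  apply le_antisymm
  · refine iSup₂_le fun S hS => ?_
    rw [Nat.cast_le_one, Finset.card_le_one]
    by_contra! hcon
    obtain ⟨a, ha, b, hb, hab⟩ := hcon
    have key : ∀ a ∈ S, ∀ b ∈ S, ¬ a < b := by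
      intro a ha b hb hlt
      obtain ⟨h, ⟨i, -, rfl⟩, hg⟩ := hS fun x => decide (x = a)
      have h1 : i ≤ a := by simpa using hg a ha
      have h2 : b < i := by simpa [hlt.ne'] using hg b hb
      omega
    rcases lt_or_gt_of_ne hab with h | h
    · exact key a ha b hb h
    · exact key b hb a ha h
  · have hS : VCShatters thresholdClass {1} := by
      intro g
      refine ⟨fun x => decide ((if g 1 then 1 else 2) ≤ x), ⟨_, ?_, rfl⟩, ?_⟩
      · split_ifs <;> norm_num
      · intro x hx
        obtain rfl := Finset.mem_singleton.1 hx
        cases hg : g 1 <;> simp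
    simpa [VCdim] using le_iSup₂ (f := fun (S : Finset ℕ) (_ : VCShatters thresholdClass S) =>
      (S.card : ℕ∞)) {1} hS

section Shattering

variable {X : Type*} [MeasurableSpace (X × Bool)] {H : Set (X → Bool)} {τ α : ℝ} {k : ℕ}
  {Ds : Fin k → Measure (X × Bool)}

/-- A family of domains on which `H` realizes all patterns of low and high errors. -/
def RealizesAllPatterns (H : Set (X → Bool)) (Ds : Fin k → Measure (X × Bool)) (τ α : ℝ) : Prop :=
  ∀ g : Fin k → Bool, ∃ h ∈ H, ∀ j,
    (g j = false → errD (Ds j) h < τ - α) ∧ (g j = true → τ < errD (Ds j) h)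

theorem RealizesAllPatterns.injective (hDs : RealizesAllPatterns H Ds τ α) (hα : 0 ≤ α) :
    Function.Injective Ds := by
  intro i j hij
  by_contra hne
  obtain ⟨h, -, hh⟩ := hDs fun l => decide (l = i)
  have h1 := (hh i).2 (by simp)
  have h2 := (hh j).1 (by simpa using fun e : j = i => hne e.symm)
  rw [hij] at h1
  linarith

theorem RealizesAllPatterns.alphaShattered (hDs : RealizesAllPatterns H Ds τ α) :
    AlphaShattered H (Set.range Ds) τ α := by
  classical
  intro E hE
  obtain ⟨h, hH, hh⟩ := hDs fun l => decide (Ds l ∉ E)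
  refine ⟨h, hH, fun D hD => ?_, ?_⟩
  · obtain ⟨i, rfl⟩ := hE hD
    exact (hh i).1 (by simpa using hD)
  · rintro _ ⟨⟨i, rfl⟩, hD⟩
    exact (hh i).2 (by simpa using hD)

theorem gdim_range_eq_of_alphaShattered (hinj : Function.Injective Ds)
    (hsh : AlphaShattered H (Set.range Ds) τ α) :
    Gdim H (Set.range Ds) τ α = (k : ℕ∞) := by
  classical
  have hcard : (Finset.univ.image Ds).card = k := by
    rw [Finset.card_image_of_injective _ hinj, Finset.card_fin]
  apply le_antisymm
  · refine iSup₂_le fun S hS => ?_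
    rw [Nat.cast_le, ← hcard]
    refine Finset.card_le_card fun D hD => ?_
    simpa using hS.1 hD
  · have h : ((Finset.univ.image Ds : Finset _) : Set (Measure (X × Bool))) ⊆ Set.range Ds ∧
        AlphaShattered H ((Finset.univ.image Ds : Finset _) : Set (Measure (X × Bool))) τ α := by
      simpa using hsh
    have := le_iSup₂ (f := fun (S : Finset (Measure (X × Bool)))
      (_ : (S : Set (Measure (X × Bool))) ⊆ Set.range Ds ∧
        AlphaShattered H (S : Set (Measure (X × Bool))) τ α) => (S.card : ℕ∞)) _ h
    simpa only [hcard, Gdim] using this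

end Shattering

/-- The measure with mass `c` at `(0, 1)`, mass `d` at `(0, 0)`, and mass `δ` at each of
`(y, 1)` and `(y + 1, 0)` for every `y ∈ A`. -/
noncomputable def pairMeasure (c d δ : ℝ≥0) (A : Finset ℕ) : Measure (ℕ × Bool) :=
  c • Measure.dirac (0, true) + d • Measure.dirac (0, false) +
    δ • ∑ y ∈ A, (Measure.dirac (y, true) + Measure.dirac (y + 1, false))

theorem isProbabilityMeasure_pairMeasure {c d δ : ℝ≥0} {A : Finset ℕ}
    (h : c + d + δ * (A.card * 2) = 1) : IsProbabilityMeasure (pairMeasure c d δ A) := by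
  constructor
  have h' : (c : ℝ≥0∞) + d + δ * (A.card * 2) = 1 := by exact_mod_cast h
  simp only [pairMeasure, Measure.add_apply, Measure.smul_apply, Measure.finsetSum_apply,
    measure_univ, ENNReal.smul_def, smul_eq_mul, mul_one, one_add_one_eq_two,
    Finset.sum_const, nsmul_eq_mul]
  exact h'

/-- The threshold `h_{n+1}` errs on both points of the pair of `n`, and on exactly one point
of every other pair. -/
theorem errD_pairMeasure (c d δ : ℝ≥0) (A : Finset ℕ) (n : ℕ) :
    errD (pairMeasure c d δ A) (fun x => decide (n + 1 ≤ x)) =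
      c + δ * (A.card + if n ∈ A then 1 else 0) := by
  have hpair (y : ℕ) :
      ({p : ℕ × Bool | p.2 ≠ decide (n + 1 ≤ p.1)}.indicator (1 : ℕ × Bool → ℝ≥0∞) (y, true) +
      {p : ℕ × Bool | p.2 ≠ decide (n + 1 ≤ p.1)}.indicator (1 : ℕ × Bool → ℝ≥0∞) (y + 1, false))
        = 1 + if n = y then 1 else 0 := by
    rcases lt_trichotomy n y with h | rfl | h
    · simp [h.ne, h.le, h]
    · simp
    · simp [h.ne', h, h.le]
  have hval : pairMeasure c d δ A {p : ℕ × Bool | p.2 ≠ decide (n + 1 ≤ p.1)} =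
      ((c + δ * (A.card + if n ∈ A then 1 else 0) : ℝ≥0) : ℝ≥0∞) := by
    simp only [pairMeasure, Measure.add_apply, Measure.smul_apply, Measure.finsetSum_apply,
      Measure.dirac_apply, hpair]
    simp only [Finset.sum_add_distrib, Finset.sum_ite_eq]
    split_ifs <;> simp [ENNReal.smul_def, mul_add]
  rw [errD, hval, ENNReal.coe_toReal]
  split_ifs <;> simp

theorem exists_two_pow_mul_le {α : ℝ} (h0 : 0 < α) (h1 : α < 1 / 12) :
    ∃ k : ℕ, 2 ^ k * α ≤ 1 / 6 ∧ 1 / 24 * Real.log (1 / α) ≤ k := by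
  obtain ⟨k, hk, hk'⟩ := exists_nat_pow_near (x := 1 / (6 * α)) (y := (2 : ℝ))
    (by rw [le_div_iff₀ (by positivity)]; linarith) (by norm_num)
  rw [le_div_iff₀ (by positivity)] at hk
  rw [div_lt_iff₀ (by positivity)] at hk'
  refine ⟨k, by linarith, ?_⟩
  have hk1 : 1 ≤ k := by
    rcases Nat.eq_zero_or_pos k with rfl | h
    · norm_num at hk'
      linarith
    · exact h
  have h12 : (12 : ℝ) ≤ 12 ^ k := le_self_pow₀ (by norm_num) (by omega)
  have hle : 1 / α ≤ 24 ^ k := by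
    rw [div_le_iff₀ h0]
    have h24 : (24 : ℝ) ^ k = 12 ^ k * 2 ^ k := by rw [← mul_pow]; norm_num
    have hpos : 0 < (2 : ℝ) ^ k * α := by positivity
    rw [pow_succ] at hk'
    rw [h24]
    nlinarith
  have hlog : Real.log (1 / α) ≤ k * Real.log 24 := by
    rw [← Real.log_pow]
    exact Real.log_le_log (by positivity) hle
  have h24 : Real.log 24 ≤ 24 := Real.log_le_self (by norm_num)
  have : (k : ℝ) * Real.log 24 ≤ k * 24 := by gcongr
  linarith

/-- If `2 ^ k * α ≤ 1 / 6`, then `k` domains can read off the binary digits of the threshold. -/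
theorem exists_realizesAllPatterns {α : ℝ} (h0 : 0 < α) (h1 : α < 1 / 12) {k : ℕ}
    (hk : 2 ^ k * α ≤ 1 / 6) :
    ∃ Ds : Fin k → Measure (ℕ × Bool), (∀ i, IsProbabilityMeasure (Ds i)) ∧
      RealizesAllPatterns thresholdClass Ds (3 / 10) α := by
  let A (j : Fin k) : Finset ℕ := {y ∈ Finset.range (2 ^ k) | y.testBit j}
  have hA (j : Fin k) : 6 / 5 * α * (A j).card ≤ 1 / 5 := by
    have : ((A j).card : ℝ) ≤ 2 ^ k := by
      exact_mod_cast (Finset.card_filter_le _ _).trans_eq (Finset.card_range _)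
    nlinarith
  obtain ⟨δ, hδ⟩ : ∃ δ : ℝ≥0, (δ : ℝ) = 6 / 5 * α := ⟨⟨_, by positivity⟩, rfl⟩
  have hc (j : Fin k) : ∃ c : ℝ≥0, (c : ℝ) = 3 / 10 - 11 / 10 * α - 6 / 5 * α * (A j).card :=
    ⟨⟨_, by linarith [hA j]⟩, rfl⟩
  have hd (j : Fin k) : ∃ d : ℝ≥0, (d : ℝ) = 7 / 10 + 11 / 10 * α - 6 / 5 * α * (A j).card :=
    ⟨⟨_, by linarith [hA j]⟩, rfl⟩
  choose c hc using hc
  choose d hd using hd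
  refine ⟨fun j => pairMeasure (c j) (d j) δ (A j), fun j => ?_, fun g => ?_⟩
  · apply isProbabilityMeasure_pairMeasure
    rw [← NNReal.coe_inj]
    push_cast
    rw [hc, hd, hδ]
    ring
  · refine ⟨_, ⟨Nat.ofBits g + 1, by omega, rfl⟩, fun j => ?_⟩
    have hmem : Nat.ofBits g ∈ A j ↔ g j = true := by
      simp [A, Nat.ofBits_lt_two_pow, Nat.testBit_ofBits_lt]
    simp only [errD_pairMeasure, hmem, hc, hδ]
    constructor <;> intro hg <;> simp only [hg] <;> norm_num <;> linarith

/-- the `d = 1` case of Theorem 5.1: there is an absolute constant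
`c > 0` such that the threshold class `H = {h_i : i ≥ 1}` on `ℕ` has VC dimension `1`,
and for every `α ∈ (0, 1/12)` there exist `k ≥ c·log(1/α)` domains `D_1, …, D_k` on
`ℕ × {0,1}` whose set is `α`-shattered by `H` at threshold `3/10`, i.e.
`Gdim(H, {D_1,…,D_k}, 3/10, α) = k`. -/
theorem threshold_class_large_gdim :
    ∃ c : ℝ, 0 < c ∧
      VCdim thresholdClass = (1 : ℕ∞) ∧
      ∀ α : ℝ, α ∈ Set.Ioo (0:ℝ) (1/12) →
        ∃ (k : ℕ) (Ds : Fin k → Measure (ℕ × Bool)),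
          c * Real.log (1 / α) ≤ (k : ℝ) ∧
          (∀ i, IsProbabilityMeasure (Ds i)) ∧
          Function.Injective Ds ∧
          AlphaShattered thresholdClass (Set.range Ds) (3/10) α ∧
          Gdim thresholdClass (Set.range Ds) (3/10) α = (k : ℕ∞) := by
  refine ⟨1 / 24, by norm_num, vcdim_thresholdClass, fun α hα => ?_⟩
  obtain ⟨k, hk, hlog⟩ := exists_two_pow_mul_le hα.1 hα.2
  obtain ⟨Ds, hprob, hDs⟩ := exists_realizesAllPatterns hα.1 hα.2 hk
  have hinj := hDs.injective hα.1.le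
  exact ⟨k, Ds, hlog, hprob, hinj, hDs.alphaShattered,
    gdim_range_eq_of_alphaShattered hinj hDs.alphaShattered⟩
end
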